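/- arXiv:2107.12861 — 11 statements merged into one kernel-verified Lean document; each statement's English description precedes it below -/
import Mathlib

section
/- The rewriting system T₂ = {((ab^i c)², ε) : i ≥ 1} on A = {a,b,c} is locally confluent: whenever u →_{T₂} v and u →_{T₂} w, there exists a word z with v →*_{T₂} z and w →*_{T₂} z. -/
open Computability

/-- The three-letter alphabet `A = {a, b, c}`. -/
inductive Letter : Type
  | a | b | c

/-- The word `a b^i c` as a list of letters. -/
def wdL (i : ℕ) : List Letter := [Letter.a] ++ List.replicate i Letter.b ++ [Letter.c]

/-- One-step rewriting relation of the system `T₂ = {((a bⁱ c)², ε) : i ≥ 1}`: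
`u →_{T₂} v` iff `u = x (a bⁱ c)² y` and `v = x y` for some words `x, y` and some `i ≥ 1`. -/
def Step (u v : List Letter) : Prop :=
  ∃ x y : List Letter, ∃ i : ℕ, 1 ≤ i ∧ u = x ++ (wdL i ++ wdL i) ++ y ∧ v = x ++ y

theorem aux_eq : ∀ (i j : ℕ) (s s' : List Letter),
    List.replicate i Letter.b ++ Letter.c :: s = List.replicate j Letter.b ++ Letter.c :: s' →
    i = j ∧ s = s'
  | 0, 0, s, s', h => by simpa using h
  | 0, j+1, s, s', h => by simp [List.replicate_succ] at h
  | i+1, 0, s, s', h => by simp [List.replicate_succ] at h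
  | i+1, j+1, s, s', h => by
      simp only [List.replicate_succ, List.cons_append, List.cons.injEq, true_and] at h
      have := aux_eq i j s s' h
      exact ⟨by omega, this.2⟩

theorem aux_split : ∀ (i : ℕ) (s t q : List Letter),
    List.replicate i Letter.b ++ Letter.c :: s = t ++ Letter.a :: q →
    ∃ t', t = List.replicate i Letter.b ++ Letter.c :: t' ∧ s = t' ++ Letter.a :: q
  | 0, s, [], q, h => by simp at h
  | 0, s, d :: t, q, h => by
      simp at h
      exact ⟨t, by simp [h.1], h.2⟩
  | i+1, s, [], q, h => by simp [List.replicate_succ] at h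
  | i+1, s, d :: t, q, h => by
      simp only [List.replicate_succ, List.cons_append, List.cons.injEq] at h
      obtain ⟨t', h1, h2⟩ := aux_split i s t q h.2
      exact ⟨t', by simp [List.replicate_succ, h1, h.1], h2⟩

theorem aux_wd (i j : ℕ) (s t s' : List Letter) (h : wdL i ++ s = t ++ (wdL j ++ s')) :
    (t = [] ∧ i = j ∧ s = s') ∨ ∃ t', t = wdL i ++ t' ∧ s = t' ++ (wdL j ++ s') := by
  cases t with
  | nil =>
    left
    simp only [wdL, List.append_assoc, List.cons_append, List.nil_append, List.cons.injEq,
      true_and] at h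
    exact ⟨rfl, aux_eq i j s s' h⟩
  | cons d t =>
    right
    simp only [wdL, List.append_assoc, List.cons_append, List.nil_append, List.cons.injEq] at h
    obtain ⟨t', h1, h2⟩ := aux_split i s t _ h.2
    exact ⟨t', by simp [wdL, h1, h.1], by simp [wdL, h2]⟩

theorem aux_main (x t y y' : List Letter) (i j : ℕ) (hi : 1 ≤ i) (hj : 1 ≤ j)
    (h : wdL i ++ (wdL i ++ y) = t ++ (wdL j ++ (wdL j ++ y'))) :
    ∃ z : List Letter, Relation.ReflTransGen Step (x ++ y) z ∧
      Relation.ReflTransGen Step (x ++ t ++ y') z := by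
  rcases aux_wd _ _ _ _ _ h with ⟨rfl, rfl, h'⟩ | ⟨t, rfl, h'⟩
  · have := List.append_cancel_left h'
    subst this
    exact ⟨x ++ y, .refl, by simpa using .refl⟩
  · rcases aux_wd _ _ _ _ _ h' with ⟨rfl, rfl, rfl⟩ | ⟨t, rfl, rfl⟩
    · exact ⟨x ++ (wdL i ++ y'), .refl, by simpa using .refl⟩
    · exact ⟨x ++ t ++ y', .single ⟨x ++ t, y', j, hj, by simp, rfl⟩,
        .single ⟨x, t ++ y', i, hi, by simp, by simp⟩⟩

/-- The rewriting system `T₂` is locally confluent. -/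
theorem T2_locally_confluent (u v w : List Letter) (hv : Step u v) (hw : Step u w) :
    ∃ z : List Letter, Relation.ReflTransGen Step v z ∧ Relation.ReflTransGen Step w z := by
  obtain ⟨x, y, i, hi, rfl, rfl⟩ := hv
  obtain ⟨x', y', j, hj, h, rfl⟩ := hw
  simp only [List.append_assoc] at h
  rcases List.append_eq_append_iff.1 h with ⟨t, rfl, h'⟩ | ⟨t, rfl, h'⟩
  · exact aux_main x t y y' i j hi hj h'
  · obtain ⟨z, h1, h2⟩ := aux_main x' t y' y j i hj hi h'
    exact ⟨z, h2, h1⟩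
end

section
/- The rewriting system T₂ = {((ab^i c)², ε) : i ≥ 1} on A = {a,b,c} is confluent: whenever u →*_{T₂} v and u →*_{T₂} w, there exists a word z with v →*_{T₂} z and w →*_{T₂} z. -/
open Computability

theorem aux1 (i j : ℕ) (y z : List Letter)
    (h : List.replicate i Letter.b ++ Letter.c :: y = List.replicate j Letter.b ++ Letter.c :: z) :
    i = j ∧ y = z := by
  induction i generalizing j with
  | zero => cases j <;> simp_all [List.replicate_succ]
  | succ n ih =>
    cases j with
    | zero => simp [List.replicate_succ] at h
    | succ m =>
      simp only [List.replicate_succ, List.cons_append, List.cons.injEq, true_and] at h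
      have := ih m h
      exact ⟨by omega, this.2⟩

theorem aux2 (i : ℕ) (y t z : List Letter)
    (h : List.replicate i Letter.b ++ Letter.c :: y = t ++ Letter.a :: z) :
    ∃ t', t = List.replicate i Letter.b ++ Letter.c :: t' ∧ y = t' ++ Letter.a :: z := by
  induction i generalizing t with
  | zero => cases t <;> simp_all
  | succ n ih =>
    cases t with
    | nil => simp [List.replicate_succ] at h
    | cons p t =>
      simp only [List.replicate_succ, List.cons_append, List.cons.injEq] at h
      obtain ⟨t', h1, h2⟩ := ih t h.2
      exact ⟨t', by simp [List.replicate_succ, ← h.1, h1], h2⟩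

theorem aux3 (i j : ℕ) (y t z : List Letter) (h : wdL i ++ y = t ++ (wdL j ++ z)) :
    (t = [] ∧ i = j ∧ y = z) ∨ ∃ t', t = wdL i ++ t' ∧ y = t' ++ (wdL j ++ z) := by
  cases t with
  | nil =>
    left
    simp only [wdL, List.append_assoc, List.cons_append, List.nil_append, List.cons.injEq,
      true_and] at h
    exact ⟨rfl, aux1 _ _ _ _ h⟩
  | cons p t =>
    right
    simp only [wdL, List.append_assoc, List.cons_append, List.nil_append, List.cons.injEq] at h
    obtain ⟨t', h1, h2⟩ := aux2 _ _ _ _ h.2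
    exact ⟨t', by simp [wdL, ← h.1, h1], by simp [wdL, h2]⟩

theorem aux4 (i j : ℕ) (hi : 1 ≤ i) (hj : 1 ≤ j) (x y t z : List Letter)
    (h : wdL i ++ (wdL i ++ y) = t ++ (wdL j ++ (wdL j ++ z))) :
    x ++ y = x ++ t ++ z ∨ ∃ d, Step (x ++ y) d ∧ Step (x ++ t ++ z) d := by
  rcases aux3 _ _ _ _ _ h with ⟨rfl, rfl, h1⟩ | ⟨t', rfl, h1⟩
  · left
    simp [List.append_cancel_left h1]
  · rcases aux3 _ _ _ _ _ h1 with ⟨rfl, rfl, rfl⟩ | ⟨t'', rfl, rfl⟩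
    · left
      simp
    · right
      exact ⟨x ++ t'' ++ z, ⟨x ++ t'', z, j, hj, by simp, rfl⟩,
        ⟨x, t'' ++ z, i, hi, by simp, by simp⟩⟩

theorem aux5 (u v w : List Letter) (hv : Step u v) (hw : Step u w) :
    v = w ∨ ∃ d, Step v d ∧ Step w d := by
  obtain ⟨x, y, i, hi, rfl, rfl⟩ := hv
  obtain ⟨x', y', j, hj, h, rfl⟩ := hw
  simp only [List.append_assoc] at h
  rcases List.append_eq_append_iff.1 h with ⟨t, rfl, h1⟩ | ⟨t, rfl, h1⟩
  · exact aux4 i j hi hj x y t y' h1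
  · rcases aux4 j i hj hi x' y' t y h1 with h2 | ⟨d, h2, h3⟩
    · exact Or.inl h2.symm
    · exact Or.inr ⟨d, h3, h2⟩

/-- The rewriting system `T₂` is confluent. -/
theorem T2_confluent (u v w : List Letter)
    (hv : Relation.ReflTransGen Step u v) (hw : Relation.ReflTransGen Step u w) :
    ∃ z : List Letter, Relation.ReflTransGen Step v z ∧ Relation.ReflTransGen Step w z := by
  refine Relation.church_rosser ?_ hv hw
  intro u v w hv hw
  rcases aux5 u v w hv hw with rfl | ⟨d, h1, h2⟩
  · exact ⟨v, .refl, .refl⟩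
  · exact ⟨d, .single h1, .single h2⟩
end

section
/- The monoid Π₂ = Mon⟨a,b,c | (ab^i c)² = 1 (i ≥ 1)⟩ has context-free word problem: the language { u # rev(v) : u, v ∈ A*, u =_{Π₂} v } over the alphabet A ∪ {#} is context-free, where # is a symbol not in A and rev(v) denotes the word v read backwards. -/
open Computability

/-- The word `a b^i c` as an element of the free monoid on `A`. -/
def wd (i : ℕ) : FreeMonoid Letter := FreeMonoid.ofList (wdL i)

/-- The defining relations of `Π₂`: `(a bⁱ c)² = 1` for every `i ≥ 1`. -/
def Pi2Rel (u v : FreeMonoid Letter) : Prop :=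
  ∃ i : ℕ, 1 ≤ i ∧ u = wd i * wd i ∧ v = 1

/-- The least congruence on `A*` identifying `(a bⁱ c)²` with the empty word for all `i ≥ 1`. -/
def Pi2Con : Con (FreeMonoid Letter) := conGen Pi2Rel

/-- The monoid `Π₂ = Mon⟨a,b,c | (a bⁱ c)² = 1 (i ≥ 1)⟩`. -/
abbrev Pi2 := Pi2Con.Quotient

/-- The word problem of `Π₂` (after Duncan & Gilman) over the alphabet `A ∪ {#}`, where the
extra symbol `#` is encoded as `none` and the letters of `A` as `some _`. -/
def WP2 : Language (Option Letter) :=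
  {l | ∃ u v : List Letter, Pi2Con (FreeMonoid.ofList u) (FreeMonoid.ofList v) ∧
    l = u.map some ++ [none] ++ (v.map some).reverse}

namespace Pi2Proof
open Letter Relation

/-! ### Confluence -/

lemma wd_split (i : ℕ) (z t s : List Letter) (h : wdL i ++ z = t ++ a :: s) :
    t = [] ∨ ∃ t', t = wdL i ++ t' ∧ z = t' ++ a :: s := by
  have key : ∀ (n : ℕ) (t : List Letter), List.replicate n b ++ c :: z = t ++ a :: s →
      ∃ t', t = List.replicate n b ++ c :: t' ∧ z = t' ++ a :: s := by
    intro n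
    induction n with
    | zero =>
      intro t h
      cases t with
      | nil => simp at h
      | cons x t =>
        simp at h
        exact ⟨t, by simp [h.1], h.2⟩
    | succ n ih =>
      intro t h
      cases t with
      | nil => simp [List.replicate_succ] at h
      | cons x t =>
        simp [List.replicate_succ] at h
        obtain ⟨t', h1, h2⟩ := ih t (by simpa using h.2)
        exact ⟨t', by simp [List.replicate_succ, h.1, h1], h2⟩
  cases t with
  | nil => exact Or.inl rfl
  | cons x t =>
    right
    simp [wdL] at h
    obtain ⟨t', h1, h2⟩ := key i t (by simpa using h.2)
    exact ⟨t', by simp [wdL, h.1, h1], h2⟩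

lemma wd_inj (i j : ℕ) (y z : List Letter) (h : wdL i ++ y = wdL j ++ z) : i = j ∧ y = z := by
  simp only [wdL, List.append_assoc, List.cons_append, List.nil_append, List.cons.injEq,
    true_and] at h
  induction i generalizing j with
  | zero => cases j <;> simp_all [List.replicate_succ]
  | succ i ih =>
    cases j with
    | zero => simp [List.replicate_succ] at h
    | succ j =>
      have := ih j (by simpa [List.replicate_succ] using h)
      simpa using this

lemma wd_cons (j : ℕ) : ∃ r, wdL j = a :: r := ⟨_, rfl⟩

lemma step_append_left {u v : List Letter} (p : List Letter) (h : Step u v) :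
    Step (p ++ u) (p ++ v) := by
  obtain ⟨x, y, i, hi, rfl, rfl⟩ := h
  exact ⟨p ++ x, y, i, hi, by simp, by simp⟩

lemma step_append_right {u v : List Letter} (p : List Letter) (h : Step u v) :
    Step (u ++ p) (v ++ p) := by
  obtain ⟨x, y, i, hi, rfl, rfl⟩ := h
  exact ⟨x, y ++ p, i, hi, by simp, by simp⟩

lemma diamond_aux (x x' y y' : List Letter) (i j : ℕ) (hi : 1 ≤ i) (hj : 1 ≤ j)
    (t : List Letter) (hx : x' = x ++ t)
    (h : wdL i ++ (wdL i ++ y) = t ++ (wdL j ++ (wdL j ++ y'))) :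
    x ++ y = x' ++ y' ∨ ∃ d, Step (x ++ y) d ∧ Step (x' ++ y') d := by
  subst hx
  obtain ⟨r, hr⟩ := wd_cons j
  have h' : wdL i ++ (wdL i ++ y) = t ++ a :: (r ++ (wdL j ++ y')) := by rw [h, hr]; simp
  rcases wd_split _ _ _ _ h' with rfl | ⟨t', rfl, h2⟩
  · obtain ⟨rfl, h3⟩ := wd_inj _ _ _ _ h
    obtain ⟨-, rfl⟩ := wd_inj _ _ _ _ h3
    left; simp
  · rcases wd_split _ _ _ _ h2 with rfl | ⟨t'', rfl, h3⟩
    · have h4 : wdL i ++ y = wdL j ++ (wdL j ++ y') := by rw [h2, hr]; simp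
      obtain ⟨rfl, rfl⟩ := wd_inj _ _ _ _ h4
      left; simp
    · right
      refine ⟨x ++ t'' ++ y', ⟨x ++ t'', y', j, hj, ?_, rfl⟩, ⟨x, t'' ++ y', i, hi, ?_, ?_⟩⟩
      · rw [h3, hr]; simp
      · simp
      · simp

lemma diamond (u v w : List Letter) (h1 : Step u v) (h2 : Step u w) :
    v = w ∨ ∃ d, Step v d ∧ Step w d := by
  obtain ⟨x, y, i, hi, rfl, rfl⟩ := h1
  obtain ⟨x', y', j, hj, h, rfl⟩ := h2
  simp only [List.append_assoc] at h
  rcases List.append_eq_append_iff.1 h with ⟨t, h3, h4⟩ | ⟨t, h3, h4⟩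
  · exact diamond_aux x x' y y' i j hi hj t h3 h4
  · rcases diamond_aux x' x y' y j i hj hi t h3 h4 with h | ⟨d, h, h'⟩
    · exact Or.inl h.symm
    · exact Or.inr ⟨d, h', h⟩

abbrev Jn (u v : List Letter) : Prop := Join (ReflTransGen Step) u v

lemma jn_equiv : Equivalence Jn := by
  apply equivalence_join_reflTransGen
  intro u v w h1 h2
  rcases diamond u v w h1 h2 with rfl | ⟨d, h, h'⟩
  · exact ⟨v, .refl, .refl⟩
  · exact ⟨d, .single h, .single h'⟩

lemma jn_append {u v u' v' : List Letter} (h : Jn u v) (h' : Jn u' v') :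
    Jn (u ++ u') (v ++ v') := by
  obtain ⟨w, h1, h2⟩ := h
  obtain ⟨w', h1', h2'⟩ := h'
  have key : ∀ {u w u' w' : List Letter}, ReflTransGen Step u w → ReflTransGen Step u' w' →
      ReflTransGen Step (u ++ u') (w ++ w') := by
    intro u w u' w' h h'
    exact (ReflTransGen.lift (· ++ u') (fun _ _ => step_append_right u') _ _ h).trans
      (ReflTransGen.lift (w ++ ·) (fun _ _ => step_append_left w) _ _ h')
  exact ⟨w ++ w', key h1 h1', key h2 h2'⟩

lemma jn_of_con {u v : FreeMonoid Letter} (h : Pi2Con u v) :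
    Jn (FreeMonoid.toList u) (FreeMonoid.toList v) := by
  change ConGen.Rel Pi2Rel u v at h
  induction h with
  | of x y h =>
    obtain ⟨i, hi, rfl, rfl⟩ := h
    refine ⟨[], .single ⟨[], [], i, hi, ?_, rfl⟩, .refl⟩
    simp [wd]
  | refl x => exact jn_equiv.refl _
  | symm h ih => exact jn_equiv.symm ih
  | trans h h' ih ih' => exact jn_equiv.trans ih ih'
  | mul h h' ih ih' =>
    rw [FreeMonoid.toList_mul, FreeMonoid.toList_mul]
    exact jn_append ih ih'

/-! ### The combinatorial description -/

inductive K : Type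
  | D | X | Y

def wraps : List (K × Letter × K × Letter) :=
  [(K.D, a, K.X, c), (K.X, b, K.Y, b), (K.Y, b, K.Y, b), (K.Y, c, K.D, a)]

inductive G : K → List Letter → Prop
  | nil : G K.D []
  | left {k u v} : G K.D u → G k v → G k (u ++ v)
  | right {k u v} : G k u → G K.D v → G k (u ++ v)
  | wrap {k' x k z u} : (k', x, k, z) ∈ wraps → G k u → G k' (x :: (u ++ [z]))

lemma wrap_split {x z : Letter} {m p q : List Letter} (h : x :: (m ++ [z]) = p ++ q) :
    p = [] ∨ q = [] ∨ ∃ p' q', p = x :: p' ∧ q = q' ++ [z] ∧ m = p' ++ q' := by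
  cases p with
  | nil => exact Or.inl rfl
  | cons y p =>
    right
    rcases List.eq_nil_or_concat q with rfl | ⟨q', w, rfl⟩
    · exact Or.inl rfl
    · right
      simp only [List.cons_append, List.cons.injEq, List.concat_eq_append] at h
      obtain ⟨rfl, h⟩ := h
      rw [← List.append_assoc] at h
      have h2 := List.append_inj' h rfl
      simp at h2
      exact ⟨p, q', rfl, by simp [h2.2], h2.1⟩

lemma G.insert {d : List Letter} (hd : G K.D d) {k : K} {w : List Letter} (h : G k w) :
    ∀ p q, w = p ++ q → G k (p ++ (d ++ q)) := by
  induction h with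
  | nil =>
    intro p q h
    simp at h
    simpa [h] using hd
  | @left k u v hu hv ihu ihv =>
    intro p q h
    rcases List.append_eq_append_iff.1 h with ⟨t, rfl, h2⟩ | ⟨t, rfl, rfl⟩
    · simpa using G.left hu (ihv _ _ h2)
    · simpa using G.left (ihu _ _ rfl) hv
  | @right k u v hu hv ihu ihv =>
    intro p q h
    rcases List.append_eq_append_iff.1 h with ⟨t, rfl, h2⟩ | ⟨t, rfl, rfl⟩
    · simpa using G.right hu (ihv _ _ h2)
    · simpa using G.right (ihu _ _ rfl) hv
  | @wrap k' x k z u hm hu ih =>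
    intro p q h
    rcases wrap_split h with rfl | rfl | ⟨p', q', rfl, rfl, h3⟩
    · rw [List.nil_append] at h
      subst h
      simpa using G.left hd (G.wrap hm hu)
    · rw [List.append_nil] at h
      subst h
      simpa using G.right (G.wrap hm hu) hd
    · simpa using G.wrap hm (ih _ _ h3)

lemma G_Y (n : ℕ) : G K.Y (List.replicate n b ++ ([c, a] ++ List.replicate n b)) := by
  induction n with
  | zero => simpa using G.wrap (k' := K.Y) (x := c) (k := K.D) (z := a) (by simp [wraps]) G.nil
  | succ n ih =>
    have := G.wrap (k' := K.Y) (x := b) (z := b) (by simp [wraps]) ih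
    nth_rewrite 1 [List.replicate_succ]
    rw [List.replicate_succ']
    simpa using this

lemma G_wd (i : ℕ) (hi : 1 ≤ i) : G K.D (wdL i ++ wdL i) := by
  obtain ⟨n, rfl⟩ : ∃ n, i = n + 1 := ⟨i - 1, by omega⟩
  have h1 := G.wrap (k' := K.X) (x := b) (z := b) (by simp [wraps]) (G_Y n)
  have h2 := G.wrap (k' := K.D) (x := a) (z := c) (by simp [wraps]) h1
  unfold wdL
  nth_rewrite 1 [List.replicate_succ]
  rw [List.replicate_succ']
  simpa using h2

inductive J : List Letter → List Letter → Prop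
  | nil : J [] []
  | cons (x) {u v} : J u v → J (x :: u) (x :: v)
  | left {d u v} : G K.D d → J u v → J (d ++ u) v
  | right {d u v} : G K.D d → J u v → J u (d ++ v)

lemma J.symm {u v} (h : J u v) : J v u := by
  induction h with
  | nil => exact .nil
  | cons x _ ih => exact .cons x ih
  | left hd _ ih => exact .right hd ih
  | right hd _ ih => exact .left hd ih

lemma J.refl (u) : J u u := by
  induction u with
  | nil => exact .nil
  | cons x _ ih => exact .cons x ih

lemma J.insert {d : List Letter} (hd : G K.D d) {w v : List Letter} (h : J w v) :
    ∀ p q, w = p ++ q → J (p ++ (d ++ q)) v := by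
  induction h with
  | nil =>
    intro p q h
    simp at h
    simpa [h] using J.left hd .nil
  | cons x hj ih =>
    intro p q h
    cases p with
    | nil =>
      rw [List.nil_append] at h
      subst h
      simpa using J.left hd (.cons x hj)
    | cons y p =>
      simp at h
      obtain ⟨rfl, h⟩ := h
      exact .cons x (ih _ _ h)
  | @left e u v he hj ih =>
    intro p q h
    rcases List.append_eq_append_iff.1 h with ⟨t, rfl, h2⟩ | ⟨t, rfl, rfl⟩
    · simpa using J.left he (ih _ _ h2)
    · simpa using J.left (G.insert hd he _ _ rfl) hj
  | right he hj ih =>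
    intro p q h
    exact .right he (ih _ _ h)

lemma J.steps {u w v} (h : ReflTransGen Step u w) (hj : J w v) : J u v := by
  induction h using ReflTransGen.head_induction_on with
  | refl => exact hj
  | head h _ ih =>
    obtain ⟨x, y, i, hi, rfl, rfl⟩ := h
    simpa using J.insert (G_wd i hi) ih _ _ rfl

lemma J_of_con {u v : List Letter} (h : Pi2Con (FreeMonoid.ofList u) (FreeMonoid.ofList v)) :
    J u v := by
  obtain ⟨w, h1, h2⟩ := jn_of_con h
  exact J.steps h1 (J.symm (J.steps h2 (J.refl _)))

abbrev F (u : List Letter) : FreeMonoid Letter := FreeMonoid.ofList u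

lemma F_append (u v : List Letter) : F (u ++ v) = F u * F v := rfl
lemma F_cons (x : Letter) (v : List Letter) : F (x :: v) = F [x] * F v := rfl

def GM : K → List Letter → Prop
  | K.D, u => Pi2Con (F u) 1
  | K.X, u => ∃ i, 1 ≤ i ∧
      Pi2Con (F u) (F (List.replicate i b ++ ([c, a] ++ List.replicate i b)))
  | K.Y, u => ∃ i, Pi2Con (F u) (F (List.replicate i b ++ ([c, a] ++ List.replicate i b)))

lemma con_wrap {u v : List Letter} (x z : Letter) (h : Pi2Con (F u) (F v)) :
    Pi2Con (F (x :: (u ++ [z]))) (F (x :: (v ++ [z]))) := by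
  change Pi2Con (F [x] * (F u * F [z])) (F [x] * (F v * F [z]))
  exact Pi2Con.mul (Pi2Con.refl _) (Pi2Con.mul h (Pi2Con.refl _))

lemma rep_wrap (i : ℕ) : b :: ((List.replicate i b ++ ([c, a] ++ List.replicate i b)) ++ [b]) =
    List.replicate (i+1) b ++ ([c, a] ++ List.replicate (i+1) b) := by
  nth_rewrite 2 [List.replicate_succ']
  simp [List.replicate_succ]

lemma GM_of_G {k u} (h : G k u) : GM k u := by
  induction h with
  | nil => exact Pi2Con.refl _
  | @left k u v hu hv ihu ihv =>
    have key : Pi2Con (F (u ++ v)) (F v) := by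
      simpa [F_append] using Pi2Con.mul ihu (Pi2Con.refl (F v))
    cases k with
    | D => exact Pi2Con.trans key ihv
    | X => obtain ⟨i, hi, h⟩ := ihv; exact ⟨i, hi, Pi2Con.trans key h⟩
    | Y => obtain ⟨i, h⟩ := ihv; exact ⟨i, Pi2Con.trans key h⟩
  | @right k u v hu hv ihu ihv =>
    have key : Pi2Con (F (u ++ v)) (F u) := by
      simpa [F_append] using Pi2Con.mul (Pi2Con.refl (F u)) ihv
    cases k with
    | D => exact Pi2Con.trans key ihu
    | X => obtain ⟨i, hi, h⟩ := ihu; exact ⟨i, hi, Pi2Con.trans key h⟩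
    | Y => obtain ⟨i, h⟩ := ihu; exact ⟨i, Pi2Con.trans key h⟩
  | @wrap k' x k z u hm hu ih =>
    simp only [wraps, List.mem_cons, Prod.mk.injEq, List.not_mem_nil, or_false] at hm
    rcases hm with ⟨rfl, rfl, rfl, rfl⟩ | ⟨rfl, rfl, rfl, rfl⟩ | ⟨rfl, rfl, rfl, rfl⟩ |
      ⟨rfl, rfl, rfl, rfl⟩
    · obtain ⟨i, hi, h⟩ := ih
      refine Pi2Con.trans (con_wrap a c h) ?_
      refine ConGen.Rel.of _ _ ⟨i, hi, ?_, rfl⟩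
      rw [wd, ← FreeMonoid.ofList_append]
      simp [wdL]
    · obtain ⟨i, h⟩ := ih
      exact ⟨i + 1, by omega, by simpa only [rep_wrap] using con_wrap b b h⟩
    · obtain ⟨i, h⟩ := ih
      exact ⟨i + 1, by simpa only [rep_wrap] using con_wrap b b h⟩
    · exact ⟨0, con_wrap (v := []) c a ih⟩

lemma con_of_J {u v} (h : J u v) : Pi2Con (F u) (F v) := by
  induction h with
  | nil => exact Pi2Con.refl _
  | @cons x u v _ ih =>
    rw [F_cons, F_cons x v]
    exact Pi2Con.mul (Pi2Con.refl _) ih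
  | @left d u v hd _ ih =>
    have : Pi2Con (F d) 1 := GM_of_G hd
    simpa [F_append] using Pi2Con.mul this ih
  | @right d u v hd _ ih =>
    have : Pi2Con (F d) 1 := GM_of_G hd
    simpa [F_append] using Pi2Con.mul (Pi2Con.symm this) ih

/-! ### The grammar -/

inductive NT : Type
  | S
  | L (k : K)
  | R (k : K)

abbrev Sy := Symbol (Option Letter) NT

abbrev nt (n : NT) : Sy := Symbol.nonterminal n
abbrev tm (x : Letter) : Sy := Symbol.terminal (some x)

inductive IsRule : NT → List Sy → Prop
  | hash : IsRule NT.S [Symbol.terminal none]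
  | conj (x : Letter) : IsRule NT.S [tm x, nt NT.S, tm x]
  | sl : IsRule NT.S [nt (NT.L K.D), nt NT.S]
  | sr : IsRule NT.S [nt NT.S, nt (NT.R K.D)]
  | lnil : IsRule (NT.L K.D) []
  | rnil : IsRule (NT.R K.D) []
  | ll (k) : IsRule (NT.L k) [nt (NT.L K.D), nt (NT.L k)]
  | lr (k) : IsRule (NT.L k) [nt (NT.L k), nt (NT.L K.D)]
  | rl (k) : IsRule (NT.R k) [nt (NT.R K.D), nt (NT.R k)]
  | rr (k) : IsRule (NT.R k) [nt (NT.R k), nt (NT.R K.D)]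
  | lw {k' x k z} : (k', x, k, z) ∈ wraps → IsRule (NT.L k') [tm x, nt (NT.L k), tm z]
  | rw {k' x k z} : (k', x, k, z) ∈ wraps → IsRule (NT.R k') [tm z, nt (NT.R k), tm x]

def ruleList : List (ContextFreeRule (Option Letter) NT) :=
  [⟨NT.S, [Symbol.terminal none]⟩, ⟨NT.S, [nt (NT.L K.D), nt NT.S]⟩,
    ⟨NT.S, [nt NT.S, nt (NT.R K.D)]⟩, ⟨NT.L K.D, []⟩, ⟨NT.R K.D, []⟩] ++
  [a, b, c].map (fun x => ⟨NT.S, [tm x, nt NT.S, tm x]⟩) ++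
  [K.D, K.X, K.Y].flatMap (fun k =>
    [⟨NT.L k, [nt (NT.L K.D), nt (NT.L k)]⟩, ⟨NT.L k, [nt (NT.L k), nt (NT.L K.D)]⟩,
     ⟨NT.R k, [nt (NT.R K.D), nt (NT.R k)]⟩, ⟨NT.R k, [nt (NT.R k), nt (NT.R K.D)]⟩]) ++
  wraps.flatMap (fun t =>
    [⟨NT.L t.1, [tm t.2.1, nt (NT.L t.2.2.1), tm t.2.2.2]⟩,
     ⟨NT.R t.1, [tm t.2.2.2, nt (NT.R t.2.2.1), tm t.2.1]⟩])

lemma mem_ruleList {n : NT} {o : List Sy} (h : IsRule n o) :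
    (⟨n, o⟩ : ContextFreeRule (Option Letter) NT) ∈ ruleList := by
  cases h with
  | hash => simp [ruleList]
  | conj x => cases x <;> simp [ruleList]
  | sl => simp [ruleList]
  | sr => simp [ruleList]
  | lnil => simp [ruleList]
  | rnil => simp [ruleList]
  | ll k => cases k <;> simp [ruleList]
  | lr k => cases k <;> simp [ruleList]
  | rl k => cases k <;> simp [ruleList]
  | rr k => cases k <;> simp [ruleList]
  | lw h =>
    refine List.mem_append_right _ (List.mem_flatMap.2 ⟨_, h, ?_⟩)
    simp
  | rw h =>
    refine List.mem_append_right _ (List.mem_flatMap.2 ⟨_, h, ?_⟩)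
    simp

lemma isRule_of_mem (r : ContextFreeRule (Option Letter) NT) (h : r ∈ ruleList) :
    IsRule r.input r.output := by
  rcases List.mem_append.1 h with h | h
  · rcases List.mem_append.1 h with h | h
    · rcases List.mem_append.1 h with h | h
      · simp only [List.mem_cons, List.not_mem_nil, or_false] at h
        rcases h with rfl | rfl | rfl | rfl | rfl <;> constructor
      · obtain ⟨x, -, rfl⟩ := List.mem_map.1 h
        constructor
    · obtain ⟨k, -, h⟩ := List.mem_flatMap.1 h
      simp only [List.mem_cons, List.not_mem_nil, or_false] at h
      rcases h with rfl | rfl | rfl | rfl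
      · exact .ll k
      · exact .lr k
      · exact .rl k
      · exact .rr k
  · obtain ⟨⟨k', x, k, z⟩, hm, h⟩ := List.mem_flatMap.1 h
    simp only [List.mem_cons, List.not_mem_nil, or_false] at h
    rcases h with rfl | rfl
    · exact .lw hm
    · exact .rw hm

open Classical in
noncomputable def gram : ContextFreeGrammar (Option Letter) where
  NT := NT
  initial := NT.S
  rules := ruleList.toFinset

open Classical in
lemma mem_gram (r : ContextFreeRule (Option Letter) NT) :
    r ∈ gram.rules ↔ r ∈ ruleList := List.mem_toFinset

def M : NT → List (Option Letter) → Prop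
  | NT.S, w => ∃ u v, J u v ∧ w = u.map some ++ ([none] ++ (v.map some).reverse)
  | NT.L k, w => ∃ u, G k u ∧ w = u.map some
  | NT.R k, w => ∃ u, G k u ∧ w = (u.map some).reverse

def Sem : List Sy → List (Option Letter) → Prop
  | [], w => w = []
  | Symbol.terminal t :: s, w => ∃ w', w = t :: w' ∧ Sem s w'
  | Symbol.nonterminal n :: s, w => ∃ u v, w = u ++ v ∧ M n u ∧ Sem s v

lemma sem_append (s s' : List Sy) (w) :
    Sem (s ++ s') w ↔ ∃ u v, w = u ++ v ∧ Sem s u ∧ Sem s' v := by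
  induction s generalizing w with
  | nil => simp [Sem]
  | cons x s ih =>
    cases x with
    | terminal t =>
      simp only [List.cons_append, Sem, ih]
      constructor
      · rintro ⟨_, rfl, u, v, rfl, h1, h2⟩
        exact ⟨t :: u, v, rfl, ⟨u, rfl, h1⟩, h2⟩
      · rintro ⟨_, v, rfl, ⟨u, rfl, h1⟩, h2⟩
        exact ⟨u ++ v, rfl, u, v, rfl, h1, h2⟩
    | nonterminal n =>
      simp only [List.cons_append, Sem, ih]
      constructor
      · rintro ⟨p, _, rfl, hp, u, v, rfl, h1, h2⟩
        exact ⟨p ++ u, v, by simp, ⟨p, u, rfl, hp, h1⟩, h2⟩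
      · rintro ⟨_, v, rfl, ⟨p, u, rfl, hp, h1⟩, h2⟩
        exact ⟨p, u ++ v, by simp, hp, u, v, rfl, h1, h2⟩

lemma sem_rule {n o} (h : IsRule n o) {w} (hw : Sem o w) : M n w := by
  cases h with
  | hash =>
    obtain ⟨_, rfl, rfl⟩ := hw
    exact ⟨[], [], .nil, rfl⟩
  | conj x =>
    obtain ⟨_, rfl, _, _, rfl, ⟨u, v, hj, rfl⟩, _, rfl, rfl⟩ := hw
    exact ⟨_, _, .cons x hj, by simp⟩
  | sl =>
    obtain ⟨_, _, rfl, ⟨d, hd, rfl⟩, _, _, rfl, ⟨u, v, hj, rfl⟩, rfl⟩ := hw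
    exact ⟨_, _, .left hd hj, by simp⟩
  | sr =>
    obtain ⟨_, _, rfl, ⟨u, v, hj, rfl⟩, _, _, rfl, ⟨d, hd, rfl⟩, rfl⟩ := hw
    exact ⟨_, _, .right hd hj, by simp⟩
  | lnil => exact ⟨[], .nil, hw⟩
  | rnil => exact ⟨[], .nil, hw⟩
  | ll k =>
    obtain ⟨_, _, rfl, ⟨d, hd, rfl⟩, _, _, rfl, ⟨u, hu, rfl⟩, rfl⟩ := hw
    exact ⟨_, .left hd hu, by simp⟩
  | lr k =>
    obtain ⟨_, _, rfl, ⟨d, hd, rfl⟩, _, _, rfl, ⟨u, hu, rfl⟩, rfl⟩ := hw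
    exact ⟨_, .right hd hu, by simp⟩
  | rl k =>
    obtain ⟨_, _, rfl, ⟨d, hd, rfl⟩, _, _, rfl, ⟨u, hu, rfl⟩, rfl⟩ := hw
    exact ⟨_, .right hu hd, by simp⟩
  | rr k =>
    obtain ⟨_, _, rfl, ⟨d, hd, rfl⟩, _, _, rfl, ⟨u, hu, rfl⟩, rfl⟩ := hw
    exact ⟨_, .left hu hd, by simp⟩
  | lw hm =>
    obtain ⟨_, rfl, _, _, rfl, ⟨u, hu, rfl⟩, _, rfl, rfl⟩ := hw
    exact ⟨_, .wrap hm hu, by simp⟩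
  | rw hm =>
    obtain ⟨_, rfl, _, _, rfl, ⟨u, hu, rfl⟩, _, rfl, rfl⟩ := hw
    exact ⟨_, .wrap hm hu, by simp⟩

lemma sem_terminals (w : List (Option Letter)) : Sem (w.map Symbol.terminal) w := by
  induction w with
  | nil => rfl
  | cons x w ih => exact ⟨w, rfl, ih⟩

lemma sem_of_derives {s s' : List Sy} (h : gram.Derives s s') {w} (hw : Sem s' w) : Sem s w := by
  induction h using ReflTransGen.head_induction_on with
  | refl => exact hw
  | head h _ ih =>
    obtain ⟨r, hr, h⟩ := h
    have hr' : IsRule r.input r.output := isRule_of_mem r ((mem_gram r).1 hr)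
    obtain ⟨p, q, rfl, rfl⟩ := h.exists_parts
    obtain ⟨_, v, rfl, h1, h2⟩ := (sem_append _ _ _).1 ih
    obtain ⟨u1, u2, rfl, h3, h4⟩ := (sem_append _ _ _).1 h1
    refine (sem_append _ _ _).2 ⟨_, v, rfl, (sem_append _ _ _).2 ⟨u1, u2, rfl, h3, ?_⟩, h2⟩
    exact ⟨u2, [], by simp, sem_rule hr' h4, rfl⟩

abbrev Dv (s s' : List Sy) : Prop := gram.Derives s s'

lemma Dv.rule {n o s} (h : IsRule n o) (h' : Dv o s) : Dv [nt n] s := by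
  refine ReflTransGen.head ?_ h'
  refine ⟨⟨n, o⟩, ?_, ContextFreeRule.Rewrites.input_output⟩
  have := mem_ruleList h
  exact (mem_gram _).2 this

lemma Dv.append {s1 s2 t1 t2 : List Sy} (h : Dv s1 t1) (h' : Dv s2 t2) :
    Dv (s1 ++ s2) (t1 ++ t2) :=
  (ContextFreeGrammar.Derives.append_right h s2).trans
    (ContextFreeGrammar.Derives.append_left h' t1)

lemma Dv.rfl' (s : List Sy) : Dv s s := ReflTransGen.refl

abbrev tms (w : List (Option Letter)) : List Sy := w.map Symbol.terminal

lemma dv_L {k u} (h : G k u) : Dv [nt (NT.L k)] (tms (u.map some)) := by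
  induction h with
  | nil => exact Dv.rule .lnil (Dv.rfl' _)
  | left _ _ ih ih' => exact Dv.rule (.ll _) (by simpa [tms] using Dv.append ih ih')
  | right _ _ ih ih' => exact Dv.rule (.lr _) (by simpa [tms] using Dv.append ih ih')
  | @wrap k' x k z u hm _ ih =>
    exact Dv.rule (.lw hm)
      (by simpa [tms] using Dv.append (Dv.append (Dv.rfl' [tm x]) ih) (Dv.rfl' [tm z]))

lemma dv_R {k u} (h : G k u) : Dv [nt (NT.R k)] (tms (u.map some).reverse) := by
  induction h with
  | nil => exact Dv.rule .rnil (Dv.rfl' _)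
  | left _ _ ih ih' => exact Dv.rule (.rr _) (by simpa [tms] using Dv.append ih' ih)
  | right _ _ ih ih' => exact Dv.rule (.rl _) (by simpa [tms] using Dv.append ih' ih)
  | @wrap k' x k z u hm _ ih =>
    exact Dv.rule (.rw hm)
      (by simpa [tms] using Dv.append (Dv.append (Dv.rfl' [tm z]) ih) (Dv.rfl' [tm x]))

lemma dv_S {u v} (h : J u v) :
    Dv [nt NT.S] (tms (u.map some ++ ([none] ++ (v.map some).reverse))) := by
  induction h with
  | nil => exact Dv.rule .hash (Dv.rfl' _)
  | cons x _ ih =>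
    exact Dv.rule (.conj x)
      (by simpa [tms] using Dv.append (Dv.append (Dv.rfl' [tm x]) ih) (Dv.rfl' [tm x]))
  | left hd _ ih => exact Dv.rule .sl (by simpa [tms] using Dv.append (dv_L hd) ih)
  | right hd _ ih => exact Dv.rule .sr (by simpa [tms] using Dv.append ih (dv_R hd))

lemma gram_language : gram.language = WP2 := by
  ext w
  constructor
  · intro h
    obtain ⟨_, _, rfl, ⟨u, v, hj, rfl⟩, rfl⟩ := sem_of_derives h (sem_terminals w)
    exact ⟨u, v, con_of_J hj, by simp⟩
  · rintro ⟨u, v, h, rfl⟩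
    have := dv_S (J_of_con h)
    rw [← List.append_assoc] at this
    exact this

end Pi2Proof

/-- The monoid `Π₂` has context-free word problem. -/
theorem Pi2_context_free : WP2.IsContextFree := by
  exact ⟨Pi2Proof.gram, Pi2Proof.gram_language⟩
end

section
/- There is no word u ∈ A* such that u·a =_{Π₂} 1 in Π₂ = Mon⟨a,b,c | (ab^i c)² = 1 (i ≥ 1)⟩. In particular, the element of Π₂ represented by the letter a is not a unit. -/
open Computability

/-- Images of the letters in the monoid of self-maps of `ℕ`: `a` is the predecessor, `b` the
identity, `c` the successor, so that every `a bⁱ c` acts trivially. -/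
def letMap : Letter → Function.End ℕ
  | Letter.a => (Nat.pred : ℕ → ℕ)
  | Letter.b => 1
  | Letter.c => (Nat.succ : ℕ → ℕ)

def repF : FreeMonoid Letter →* Function.End ℕ := FreeMonoid.lift letMap

theorem repF_wd (i : ℕ) : repF (wd i) = 1 := by
  have h : wd i = FreeMonoid.of Letter.a * FreeMonoid.of Letter.b ^ i * FreeMonoid.of Letter.c := by
    have hb : FreeMonoid.ofList (List.replicate i Letter.b) = FreeMonoid.of Letter.b ^ i := by
      induction i with
      | zero => rfl
      | succ n ih =>
        rw [pow_succ', ← ih]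
        rfl
    rw [← hb]
    rfl
  rw [h]
  simp only [repF, map_mul, map_pow, FreeMonoid.lift_eval_of]
  have hb : letMap Letter.b = 1 := rfl
  rw [hb, one_pow, mul_one]
  rfl

theorem Pi2Con_le_ker : Pi2Con ≤ Con.ker repF := by
  refine Con.conGen_le.2 ?_
  rintro u v ⟨i, -, rfl, rfl⟩
  simp [Con.ker_rel, repF_wd]

theorem no_left_inv (w : FreeMonoid Letter) : ¬ Pi2Con (w * FreeMonoid.of Letter.a) 1 := by
  intro h
  have h1 : repF (w * FreeMonoid.of Letter.a) = repF 1 := Pi2Con_le_ker h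
  rw [map_mul, map_one] at h1
  have h2 : repF (FreeMonoid.of Letter.a) = letMap Letter.a := FreeMonoid.lift_eval_of _ _
  rw [h2] at h1
  have e0 : repF w 0 = 0 := congrFun h1 0
  have e1 : repF w 0 = 1 := congrFun h1 1
  omega

/-- There is no word `u` with `u · a =_{Π₂} 1`; in particular, the element of `Π₂`
represented by the letter `a` is not a unit. -/
theorem a_not_left_invertible :
    (¬ ∃ u : List Letter, Pi2Con (FreeMonoid.ofList (u ++ [Letter.a])) 1) ∧
      ¬ IsUnit (Pi2Con.mk' (FreeMonoid.of Letter.a)) := by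
  refine ⟨fun ⟨u, hu⟩ => no_left_inv (FreeMonoid.ofList u) hu, fun h => ?_⟩
  obtain ⟨m, hm⟩ := h.exists_left_inv
  obtain ⟨w, rfl⟩ := Con.mk'_surjective m
  rw [← map_mul, ← map_one Pi2Con.mk'] at hm
  exact no_left_inv w ((Con.eq _).1 hm)
end

section
/- For every integer i ≥ 1, the word ab^i c is a minimal invertible word of Π₂ = Mon⟨a,b,c | (ab^i c)² = 1 (i ≥ 1)⟩: the element of Π₂ represented by ab^i c is a unit, and no non-empty proper prefix of ab^i c represents a unit of Π₂. Consequently, the factorisation of the defining word (ab^i c)² into minimal invertible factors is (ab^i c)(ab^i c). -/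
open Computability

/-- A word is invertible in `Π₂` if it represents a unit of `Π₂`. -/
def InvWord (w : List Letter) : Prop := IsUnit (Pi2Con.mk' (FreeMonoid.ofList w))

/-- A minimal invertible word: non-empty, invertible, and with no non-empty proper
invertible prefix. -/
def MinInvWord (w : List Letter) : Prop :=
  w ≠ [] ∧ InvWord w ∧ ∀ p : List Letter, p ≠ [] → p <+: w → p ≠ w → ¬ InvWord p

def phiL : Letter → Function.End ℕ
  | Letter.a => Nat.pred
  | Letter.b => (1 : Function.End ℕ)
  | Letter.c => Nat.succ

def phi : FreeMonoid Letter →* Function.End ℕ := FreeMonoid.lift phiL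

theorem phi_ab (j : ℕ) :
    phi (FreeMonoid.ofList (Letter.a :: List.replicate j Letter.b)) = Nat.pred := by
  have hb : phiL Letter.b = 1 := rfl
  have h : phi (FreeMonoid.ofList (Letter.a :: List.replicate j Letter.b)) = phiL Letter.a := by
    simp [phi, FreeMonoid.lift_apply, hb]
  exact h

theorem phi_wd (i : ℕ) : phi (wd i) = 1 := by
  have hb : phiL Letter.b = 1 := rfl
  have h : phi (wd i) = phiL Letter.a * phiL Letter.c := by
    simp [phi, wd, wdL, FreeMonoid.lift_apply, hb]
  rw [h]
  funext n
  rfl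

theorem Pi2Con_le : Pi2Con ≤ Con.ker phi := by
  refine Con.conGen_le.2 ?_
  rintro u v ⟨i, _, rfl, rfl⟩
  rw [Con.ker_rel]
  simp [phi_wd]

theorem not_inv_ab (j : ℕ) : ¬ InvWord (Letter.a :: List.replicate j Letter.b) := by
  intro h
  have h2 := h.map (Con.lift Pi2Con phi Pi2Con_le)
  rw [Con.lift_mk', phi_ab] at h2
  obtain ⟨u, hu⟩ := h2
  have h3 : (↑u⁻¹ : Function.End ℕ) * ↑u = 1 := u.inv_mul
  rw [hu] at h3
  have h4 := congrFun h3 0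
  have h5 := congrFun h3 1
  have h6 : (0 : ℕ) = 1 := h4.symm.trans h5
  exact absurd h6 (by decide)

theorem inv_wd (i : ℕ) (hi : 1 ≤ i) : InvWord (wdL i) := by
  have h : Pi2Con.mk' (wd i) * Pi2Con.mk' (wd i) = 1 := by
    rw [← map_mul, ← map_one Pi2Con.mk']
    exact (Con.eq Pi2Con).2 (ConGen.Rel.of _ _ ⟨i, hi, rfl, rfl⟩)
  exact ⟨⟨_, _, h, h⟩, rfl⟩

theorem min_wd (i : ℕ) (hi : 1 ≤ i) : MinInvWord (wdL i) := by
  refine ⟨by simp [wdL], inv_wd i hi, ?_⟩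
  intro p hp hpre hne
  have h1 : p <+: Letter.a :: List.replicate i Letter.b := by
    rcases List.prefix_concat_iff.1 hpre with h | h
    · exact absurd h hne
    · exact h
  cases p with
  | nil => exact absurd rfl hp
  | cons x q =>
    obtain ⟨rfl, hq⟩ := List.cons_prefix_cons.1 h1
    have : q = List.replicate q.length Letter.b :=
      List.eq_replicate_iff.2 ⟨rfl, fun y hy => List.eq_of_mem_replicate (hq.subset hy)⟩
    rw [this]
    exact not_inv_ab _

theorem min_unique {v w t : List Letter} (hv : MinInvWord v) (hw : MinInvWord w)
    (h1 : v <+: t) (h2 : w <+: t) : v = w := by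
  by_contra hne
  rcases List.prefix_or_prefix_of_prefix h1 h2 with h | h
  · exact hw.2.2 v hv.1 h hne hv.2.1
  · exact hv.2.2 w hw.1 h (Ne.symm hne) hw.2.1

theorem min_peel {w t : List Letter} (hw : MinInvWord w) (L : List (List Letter))
    (hL : ∀ v ∈ L, MinInvWord v) (h : L.flatten = w ++ t) :
    ∃ L', L = w :: L' ∧ (∀ v ∈ L', MinInvWord v) ∧ L'.flatten = t := by
  cases L with
  | nil => exact absurd (by simpa using h.symm) (fun h' : w = [] ∧ t = [] => hw.1 h'.1)
  | cons v L' =>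
    rw [List.flatten_cons] at h
    have e : v = w := min_unique (hL v (by simp)) hw (List.prefix_append v _)
      (h ▸ List.prefix_append w t)
    subst e
    exact ⟨L', rfl, fun u hu => hL u (by simp [hu]), List.append_cancel_left h⟩

/-- For every `i ≥ 1`, the word `a bⁱ c` is a minimal invertible word of `Π₂`; consequently,
the factorisation of `(a bⁱ c)²` into minimal invertible factors is `(a bⁱ c)(a bⁱ c)`. -/
theorem abic_minimal_invertible (i : ℕ) (hi : 1 ≤ i) :
    MinInvWord (wdL i) ∧
      ∀ L : List (List Letter), (∀ w ∈ L, MinInvWord w) → L.flatten = wdL i ++ wdL i →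
        L = [wdL i, wdL i] := by
  have hm := min_wd i hi
  refine ⟨hm, fun L hL h => ?_⟩
  obtain ⟨L1, rfl, h1, e1⟩ := min_peel hm L hL h
  obtain ⟨L2, rfl, h2, e2⟩ := min_peel hm L1 h1 (e1.trans (List.append_nil _).symm)
  cases L2 with
  | nil => rfl
  | cons v L3 =>
    rw [List.flatten_cons] at e2
    exact absurd (List.append_eq_nil_iff.1 e2).1 (h2 v (by simp)).1
end

section
/- Let w ∈ A* be T₂-irreducible (no factor of w is of the form (ab^i c)² with i ≥ 1) and right invertible in Π₂ (there exists w' ∈ A* with w·w' =_{Π₂} 1). Then w is a product of non-empty prefixes of words from Λ = { ab^i c : i ≥ 1 }; that is, w ∈ Pre(Λ)*, where Pre(Λ) is the set of non-empty prefixes of words in Λ. -/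
open Computability

/-- The set of minimal words `Λ = { a bⁱ c : i ≥ 1 }`, as a language. -/
def Lam : Language Letter := {l | ∃ i : ℕ, 1 ≤ i ∧ l = wdL i}

/-- The set `Pre(Λ)` of non-empty prefixes of words of `Λ`. -/
def PreLam : Language Letter := {p | p ≠ [] ∧ ∃ l ∈ Lam, p <+: l}


def IrrW (s : List Letter) : Prop := ∀ v : List Letter, ¬ Step s v

theorem wd_inj_aux (t t' : List Letter) : ∀ i j : ℕ,
    List.replicate i Letter.b ++ Letter.a :: t = List.replicate j Letter.b ++ Letter.a :: t' →
    i = j ∧ t = t'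
  | 0, 0, h => by simpa using h
  | 0, j+1, h => by simp [List.replicate_succ] at h
  | i+1, 0, h => by simp [List.replicate_succ] at h
  | i+1, j+1, h => by
    simp only [List.replicate_succ, List.cons_append, List.cons.injEq, true_and] at h
    have := wd_inj_aux t t' i j h
    exact ⟨by omega, this.2⟩

theorem wd_inj {t t' : List Letter} {i j : ℕ} (h : t ++ wdL i = t' ++ wdL j) :
    i = j ∧ t = t' := by
  have h2 := congrArg List.reverse h
  simp only [wdL, List.reverse_append, List.reverse_replicate, List.reverse_cons, List.reverse_nil,
    List.nil_append, List.append_assoc, List.cons_append, List.cons.injEq, true_and] at h2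
  have := wd_inj_aux _ _ _ _ h2
  exact ⟨this.1, List.reverse_injective this.2⟩

def Pops (s : List Letter) (t : List Letter) : Prop :=
  ∃ i : ℕ, 1 ≤ i ∧ s = t ++ (wdL i ++ wdL i)

theorem Pops.unique {s t t' : List Letter} (h : Pops s t) (h' : Pops s t') : t = t' := by
  obtain ⟨i, hi, rfl⟩ := h
  obtain ⟨j, hj, e⟩ := h'
  rw [← List.append_assoc, ← List.append_assoc] at e
  exact (wd_inj (wd_inj e).2).2

open Classical in
noncomputable def pushW (s : List Letter) (x : Letter) : List Letter :=
  if h : ∃ t, Pops (s ++ [x]) t then h.choose else s ++ [x]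

theorem push_pop {s t : List Letter} {x : Letter} (h : Pops (s ++ [x]) t) : pushW s x = t := by
  have h' : ∃ t, Pops (s ++ [x]) t := ⟨t, h⟩
  rw [pushW, dif_pos h']
  exact h'.choose_spec.unique h

theorem push_nopop {s : List Letter} {x : Letter} (h : ¬ ∃ t, Pops (s ++ [x]) t) :
    pushW s x = s ++ [x] := by
  rw [pushW, dif_neg h]

theorem IrrW.left {s u : List Letter} (h : IrrW (s ++ u)) : IrrW s := by
  rintro v ⟨x, y, i, hi, e, -⟩
  exact h (x ++ (y ++ u)) ⟨x, y ++ u, i, hi, by simp [e], rfl⟩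

theorem IrrW.not_pops {s t : List Letter} (h : IrrW s) : ¬ Pops s t := by
  rintro ⟨i, hi, e⟩
  exact h t ⟨t, [], i, hi, by simp [e], by simp⟩

theorem wdL_last (i : ℕ) : wdL i = (Letter.a :: List.replicate i Letter.b) ++ [Letter.c] := by
  simp [wdL]

theorem irr_push {s : List Letter} (x : Letter) (h : IrrW s) : IrrW (pushW s x) := by
  by_cases hp : ∃ t, Pops (s ++ [x]) t
  · obtain ⟨t, ht⟩ := hp
    rw [push_pop ht]
    obtain ⟨i, hi, e⟩ := ht
    have e2 : s ++ [x] = (t ++ (wdL i ++ (Letter.a :: List.replicate i Letter.b))) ++ [Letter.c] := by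
      rw [e]; simp [wdL]
    have := (List.append_inj' e2 rfl).1
    rw [this] at h
    exact h.left
  · rw [push_nopop hp]
    rintro v ⟨p, y, i, hi, e, -⟩
    rcases List.eq_nil_or_concat y with rfl | ⟨y', z, rfl⟩
    · exact hp ⟨p, i, hi, by simpa using e⟩
    · rw [List.concat_eq_append, ← List.append_assoc] at e
      exact h (p ++ y') ⟨p, y', i, hi, (List.append_inj' e rfl).1, rfl⟩

noncomputable def runW (s u : List Letter) : List Letter := u.foldl pushW s

theorem run_append (s u v : List Letter) : runW s (u ++ v) = runW (runW s u) v := by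
  simp [runW, List.foldl_append]

theorem irr_run (u : List Letter) : ∀ s, IrrW s → IrrW (runW s u) := by
  induction u with
  | nil => intro s h; exact h
  | cons x u ih => intro s h; exact ih _ (irr_push x h)

theorem run_irr (u : List Letter) : ∀ s, IrrW (s ++ u) → runW s u = s ++ u := by
  induction u with
  | nil => intro s h; simp [runW]
  | cons x u ih =>
    intro s h
    have e : s ++ x :: u = (s ++ [x]) ++ u := by simp
    rw [e] at h ⊢
    have hp : pushW s x = s ++ [x] := push_nopop (fun ⟨t, ht⟩ => h.left.not_pops ht)
    rw [← ih _ h, ← hp]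
    rfl

theorem run_noc (u : List Letter) : ∀ s, Letter.c ∉ u → runW s u = s ++ u := by
  induction u with
  | nil => intro s h; simp [runW]
  | cons x u ih =>
    intro s h
    simp only [List.mem_cons, not_or] at h
    have e : s ++ x :: u = (s ++ [x]) ++ u := by simp
    have hp : pushW s x = s ++ [x] := by
      apply push_nopop
      rintro ⟨t, i, hi, e⟩
      rw [wdL_last, ← List.append_assoc, ← List.append_assoc] at e
      have := (List.append_inj' e rfl).2
      simp only [List.cons.injEq, and_true] at this
      exact h.1 this.symm
    rw [e, ← ih _ h.2, ← hp]
    rfl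

theorem run_wd (s : List Letter) (i : ℕ) :
    runW s (wdL i) = pushW (s ++ Letter.a :: List.replicate i Letter.b) Letter.c := by
  rw [wdL_last, run_append, run_noc (Letter.a :: List.replicate i Letter.b)]
  · rfl
  · simp [List.mem_replicate]

theorem run_wd_pop (t : List Letter) (i : ℕ) (hi : 1 ≤ i) : runW (t ++ wdL i) (wdL i) = t := by
  rw [run_wd]
  exact push_pop ⟨i, hi, by simp [wdL]⟩

theorem run_rel (s : List Letter) (hs : IrrW s) (i : ℕ) (hi : 1 ≤ i) :
    runW s (wdL i ++ wdL i) = s := by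
  rw [run_append]
  have push_free : ∀ r : List Letter, (¬ ∃ t, r = t ++ wdL i) → runW r (wdL i) = r ++ wdL i := by
    intro r hr
    rw [run_wd, push_nopop]
    · simp [wdL]
    · rintro ⟨t, j, hj, e⟩
      have e2 : r ++ wdL i = (t ++ wdL j) ++ wdL j := by
        rw [List.append_assoc, ← e]; simp [wdL]
      obtain ⟨rfl, h⟩ := wd_inj e2
      exact hr ⟨t, h⟩
  by_cases h : ∃ t, s = t ++ wdL i
  · obtain ⟨t, rfl⟩ := h
    rw [run_wd_pop t i hi]
    apply push_free
    rintro ⟨t', rfl⟩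
    exact hs.not_pops (t := t') ⟨i, hi, by simp⟩
  · rw [push_free s h, run_wd_pop s i hi]

def runCon : Con (FreeMonoid Letter) where
  r u v := ∀ s, IrrW s → runW s (FreeMonoid.toList u) = runW s (FreeMonoid.toList v)
  iseqv := ⟨fun _ _ _ => rfl, fun h s hs => (h s hs).symm,
    fun h h' s hs => (h s hs).trans (h' s hs)⟩
  mul' := by
    intro u v u' v' h h' s hs
    rw [FreeMonoid.toList_mul, FreeMonoid.toList_mul, run_append, run_append, h s hs]
    exact h' _ (irr_run _ _ hs)

theorem run_con {u v : FreeMonoid Letter} (h : Pi2Con u v) : runCon u v := by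
  have : Pi2Con ≤ runCon := by
    apply Con.conGen_le.2
    rintro u v ⟨i, hi, rfl, rfl⟩ s hs
    exact run_rel s hs i hi
  exact this h

theorem good_dropLast {s : List Letter} {x : Letter} (h : s ++ [x] ∈ PreLam∗) : s ∈ PreLam∗ := by
  rw [Language.mem_kstar] at h ⊢
  obtain ⟨L, e, hL⟩ := h
  rcases List.eq_nil_or_concat L with rfl | ⟨L', p, rfl⟩
  · simp at e
  rw [List.concat_eq_append] at e hL
  have hp := hL p (by simp)
  obtain ⟨hne, l, hl, hpl⟩ := hp
  rcases List.eq_nil_or_concat p with rfl | ⟨p', z, rfl⟩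
  · exact absurd rfl hne
  rw [List.concat_eq_append] at e hpl
  rw [List.flatten_append, List.flatten_singleton, ← List.append_assoc] at e
  have e2 := (List.append_inj' e rfl).1
  by_cases hp' : p' = []
  · exact ⟨L', by simpa [hp'] using e2, fun y hy => hL y (by simp [hy])⟩
  · refine ⟨L' ++ [p'], by simpa using e2, ?_⟩
    intro y hy
    rcases List.mem_append.1 hy with hy | hy
    · exact hL y (by simp [hy])
    · rw [List.mem_singleton] at hy
      subst hy
      exact ⟨hp', l, hl, (List.prefix_append _ _).trans hpl⟩

theorem good_push {s : List Letter} {x : Letter} (h : pushW s x ∈ PreLam∗) : s ∈ PreLam∗ := by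
  by_cases hp : ∃ t, Pops (s ++ [x]) t
  · obtain ⟨t, ht⟩ := hp
    rw [push_pop ht] at h
    obtain ⟨i, hi, e⟩ := ht
    apply good_dropLast (x := x)
    rw [e]
    rw [Language.mem_kstar] at h ⊢
    obtain ⟨L, rfl, hL⟩ := h
    refine ⟨L ++ [wdL i, wdL i], by simp, ?_⟩
    intro y hy
    rcases List.mem_append.1 hy with hy | hy
    · exact hL y hy
    · have : y = wdL i := by simpa using hy
      subst this
      exact ⟨by simp [wdL], wdL i, ⟨i, hi, rfl⟩, List.prefix_rfl⟩
  · rw [push_nopop hp] at h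
    exact good_dropLast h

theorem good_run (u : List Letter) : ∀ s, runW s u ∈ PreLam∗ → s ∈ PreLam∗ := by
  induction u with
  | nil => intro s h; exact h
  | cons x u ih => intro s h; exact good_push (ih _ h)

/-- Every `T₂`-irreducible word that is right invertible in `Π₂` lies in `Pre(Λ)*`. -/
theorem irreducible_right_invertible_mem_PreLam_star (w : List Letter)
    (hirr : ∀ v : List Letter, ¬ Step w v)
    (hrinv : ∃ w' : List Letter, Pi2Con (FreeMonoid.ofList (w ++ w')) 1) :
    w ∈ PreLam∗ := by
  obtain ⟨w', h⟩ := hrinv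
  have hw : IrrW ([] ++ w) := hirr
  have h1 : runW [] (w ++ w') = [] := run_con h [] hw.left
  rw [run_append, run_irr w [] hw, List.nil_append] at h1
  apply good_run w'
  rw [h1]
  exact Language.nil_mem_kstar _
end

section
/- Let u ∈ A* be T₂-irreducible (no factor of u is of the form (ab^i c)² with i ≥ 1) and invertible in Π₂ (u represents a unit of Π₂). Then u ∈ Λ*, i.e. u is a concatenation of words from Λ = { ab^i c : i ≥ 1 }. -/
open Computability

open Letter

namespace Aux

def Irr (u : List Letter) : Prop := ∀ v, ¬ Step u v

theorem wdL_eq (i : ℕ) : wdL i = a :: (List.replicate i b ++ [c]) := by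
  simp [wdL]

theorem rep_inj (i j : ℕ) (t t' : List Letter)
    (h : List.replicate i b ++ c :: t = List.replicate j b ++ c :: t') : i = j ∧ t = t' := by
  induction i generalizing j with
  | zero => cases j with
    | zero => simpa using h
    | succ j => simp [List.replicate_succ] at h
  | succ i ih => cases j with
    | zero => simp [List.replicate_succ] at h
    | succ j =>
      simp [List.replicate_succ] at h
      have := ih j h
      simpa using this

theorem wdL_inj (i j : ℕ) (t t' : List Letter)
    (h : wdL i ++ t = wdL j ++ t') : i = j ∧ t = t' := by
  apply rep_inj
  simpa [wdL_eq] using h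

def Pop (s t : List Letter) : Prop := ∃ i, 1 ≤ i ∧ s = wdL i ++ (wdL i ++ t)

theorem Pop.unique {s t t' : List Letter} (h : Pop s t) (h' : Pop s t') : t = t' := by
  obtain ⟨i, _, rfl⟩ := h
  obtain ⟨j, _, h⟩ := h'
  obtain ⟨rfl, h⟩ := wdL_inj _ _ _ _ h
  exact (wdL_inj _ _ _ _ h).2

open Classical in
noncomputable def st (x : Letter) (s : List Letter) : List Letter :=
  if h : ∃ t, Pop (x :: s) t then h.choose else x :: s

theorem st_pop {x : Letter} {s t : List Letter} (h : Pop (x :: s) t) : st x s = t := by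
  have h' : ∃ t, Pop (x :: s) t := ⟨t, h⟩
  rw [st, dif_pos h']
  exact h'.choose_spec.unique h

theorem st_push {x : Letter} {s : List Letter} (h : ¬ ∃ t, Pop (x :: s) t) : st x s = x :: s := by
  rw [st, dif_neg h]

theorem st_ne {x : Letter} {s : List Letter} (h : x ≠ a) : st x s = x :: s := by
  apply st_push
  rintro ⟨t, i, _, h'⟩
  simp [wdL_eq] at h'
  exact h h'.1

theorem Irr.suffix {x y : List Letter} (h : Irr (x ++ y)) : Irr y := by
  rintro v ⟨p, q, i, hi, rfl, rfl⟩
  exact h (x ++ p ++ q) ⟨x ++ p, q, i, hi, by simp, by simp⟩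

theorem Irr.noPop {s : List Letter} (h : Irr s) : ¬ ∃ t, Pop s t := by
  rintro ⟨t, i, hi, rfl⟩
  exact h t ⟨[], t, i, hi, by simp, by simp⟩

theorem irr_cons {x : Letter} {s : List Letter} (h : Irr s) (h' : ¬ ∃ t, Pop (x :: s) t) :
    Irr (x :: s) := by
  rintro v ⟨p, q, i, hi, h1, rfl⟩
  cases p with
  | nil => exact h' ⟨q, i, hi, by simpa using h1⟩
  | cons y p =>
    simp at h1
    exact h (p ++ q) ⟨p, q, i, hi, by simpa using h1.2, rfl⟩

theorem irr_st {x : Letter} {s : List Letter} (h : Irr s) : Irr (st x s) := by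
  by_cases h' : ∃ t, Pop (x :: s) t
  · obtain ⟨t, ht⟩ := h'
    rw [st_pop ht]
    obtain ⟨i, hi, e⟩ := ht
    simp [wdL_eq] at e
    obtain ⟨_, rfl⟩ := e
    have e : List.replicate i b ++ c :: a :: (List.replicate i b ++ c :: t)
      = (List.replicate i b ++ c :: a :: (List.replicate i b ++ [c])) ++ t := by simp
    rw [e] at h
    exact h.suffix
  · rw [st_push h']
    exact irr_cons h h'

noncomputable def act (w s : List Letter) : List Letter := w.foldr st s

theorem act_append (w w' s : List Letter) : act (w ++ w') s = act w (act w' s) := by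
  simp [act]

theorem irr_act (w : List Letter) {s : List Letter} (h : Irr s) : Irr (act w s) := by
  induction w with
  | nil => exact h
  | cons x w ih => exact irr_st ih

theorem act_rep (i : ℕ) (s : List Letter) :
    act (List.replicate i b ++ [c]) s = List.replicate i b ++ c :: s := by
  induction i with
  | zero => exact st_ne (by simp)
  | succ i ih =>
    have : act (List.replicate (i+1) b ++ [c]) s = st b (act (List.replicate i b ++ [c]) s) := by
      simp [act, List.replicate_succ]
    rw [this, ih, st_ne (by simp)]
    simp [List.replicate_succ]

theorem act_wd (i : ℕ) (s : List Letter) :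
    act (wdL i) s = st a (List.replicate i b ++ c :: s) := by
  rw [wdL_eq, ← act_rep i s]; rfl

theorem act_wd_pop (i : ℕ) (hi : 1 ≤ i) (t : List Letter) :
    act (wdL i) (wdL i ++ t) = t := by
  rw [act_wd]
  exact st_pop ⟨i, hi, by simp [wdL_eq]⟩

theorem act_wd_push (i : ℕ) (s : List Letter) (h : ¬ ∃ t, s = wdL i ++ t) :
    act (wdL i) s = wdL i ++ s := by
  rw [act_wd, st_push]
  · simp [wdL_eq]
  · rintro ⟨t, j, hj, e⟩
    have e' : wdL i ++ s = wdL j ++ (wdL j ++ t) := by rw [← e]; simp [wdL_eq]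
    obtain ⟨rfl, rfl⟩ := wdL_inj _ _ _ _ e'
    exact h ⟨t, rfl⟩

theorem act_sq (i : ℕ) (hi : 1 ≤ i) (s : List Letter) (hs : Irr s) :
    act (wdL i ++ wdL i) s = s := by
  rw [act_append]
  by_cases h : ∃ t, s = wdL i ++ t
  · obtain ⟨t, rfl⟩ := h
    rw [act_wd_pop i hi, act_wd_push]
    rintro ⟨t', rfl⟩
    exact hs.noPop ⟨t', i, hi, rfl⟩
  · rw [act_wd_push i s h, act_wd_pop i hi]

theorem act_irr (u : List Letter) (h : Irr u) : act u [] = u := by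
  induction u with
  | nil => rfl
  | cons x u ih =>
    have := ih (Irr.suffix (x := [x]) h)
    change st x (act u []) = _
    rw [this, st_push h.noPop]

theorem act_congr {w w' : FreeMonoid Letter} (h : ConGen.Rel Pi2Rel w w') :
    ∀ s, Irr s → act w.toList s = act w'.toList s := by
  induction h with
  | of x y h =>
    obtain ⟨i, hi, rfl, rfl⟩ := h
    intro s hs
    exact act_sq i hi s hs
  | refl x => intros; rfl
  | symm _ ih => intro s hs; exact (ih s hs).symm
  | trans _ _ ih ih' => intro s hs; exact (ih s hs).trans (ih' s hs)
  | mul _ _ ih ih' =>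
    intro s hs
    rw [FreeMonoid.toList_mul, FreeMonoid.toList_mul, act_append, act_append, ih' s hs]
    exact ih _ (irr_act _ hs)

/-- Allowed adjacent pairs. -/
def P (x y : Letter) : Prop := (y = a → x = c) ∧ ¬ (x = a ∧ y = c)

def Good (s : List Letter) : Prop := s.IsChain P ∧ ∀ x ∈ s.getLast?, x = c

theorem good_c {t : List Letter} (h : Good t) : Good (c :: t) := by
  cases t with
  | nil => simp [Good]
  | cons y t =>
    obtain ⟨h1, h2⟩ := h
    exact ⟨List.isChain_cons_cons.2 ⟨by simp [P], h1⟩, by simpa using h2⟩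

theorem good_b {t : List Letter} (h : Good t) (i : ℕ) : Good (List.replicate i b ++ c :: t) := by
  induction i with
  | zero => exact good_c h
  | succ i ih =>
    cases i with
    | zero =>
      obtain ⟨h1, h2⟩ := ih
      exact ⟨List.isChain_cons_cons.2 ⟨by simp [P], h1⟩, by simpa using h2⟩
    | succ i =>
      obtain ⟨h1, h2⟩ := ih
      exact ⟨List.isChain_cons_cons.2 ⟨by simp [P], h1⟩, by
        simpa [List.replicate_succ] using h2⟩

theorem good_a {t : List Letter} (h : Good t) (i : ℕ) (hi : 1 ≤ i) :
    Good (a :: (List.replicate i b ++ c :: t)) := by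
  obtain ⟨h1, h2⟩ := good_b h i
  cases i with
  | zero => omega
  | succ i =>
    exact ⟨List.isChain_cons_cons.2 ⟨by simp [P], h1⟩, by
        simpa [List.replicate_succ] using h2⟩

theorem good_tail {x : Letter} {s : List Letter} (h : Good (x :: s)) : Good s := by
  cases s with
  | nil => simp [Good]
  | cons y t =>
    obtain ⟨h1, h2⟩ := h
    exact ⟨(List.isChain_cons_cons.1 h1).2, by simpa using h2⟩

theorem good_st {x : Letter} {s : List Letter} (h : Good (st x s)) : Good s := by
  by_cases h' : ∃ t, Pop (x :: s) t
  · obtain ⟨t, ht⟩ := h'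
    rw [st_pop ht] at h
    obtain ⟨i, hi, e⟩ := ht
    simp [wdL_eq] at e
    obtain ⟨_, rfl⟩ := e
    exact good_b (good_a h i hi) i
  · rw [st_push h'] at h
    exact good_tail h

theorem good_act {w s : List Letter} (h : Good (act w s)) : Good s := by
  induction w with
  | nil => exact h
  | cons x w ih => exact ih (good_st h)

theorem irr_nil : Irr [] := by
  rintro v ⟨p, q, i, hi, h, rfl⟩
  simp [wdL_eq] at h

theorem good_of_inv {u v : List Letter} (hu : Irr u)
    (h : ConGen.Rel Pi2Rel (FreeMonoid.ofList (v ++ u)) 1) : Good u := by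
  have h1 := act_congr h [] irr_nil
  have h2 : act (v ++ u) [] = [] := h1
  rw [act_append, act_irr u hu] at h2
  apply good_act (w := v)
  rw [h2]
  simp [Good]

def sw : Letter → Letter
  | a => c
  | b => b
  | c => a

theorem sw_sw (x : Letter) : sw (sw x) = x := by cases x <;> rfl

def ph (u : List Letter) : List Letter := (u.map sw).reverse

theorem ph_append (u v : List Letter) : ph (u ++ v) = ph v ++ ph u := by simp [ph]

theorem ph_ph (u : List Letter) : ph (ph u) = u := by
  simp [ph, Function.comp_def, sw_sw]

theorem ph_wd (i : ℕ) : ph (wdL i) = wdL i := by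
  simp [ph, wdL, sw]

theorem irr_ph {u : List Letter} (h : Irr u) : Irr (ph u) := by
  rintro v ⟨x, y, i, hi, e, rfl⟩
  apply h (ph y ++ ph x)
  refine ⟨ph y, ph x, i, hi, ?_, rfl⟩
  rw [← ph_ph u, e]
  simp [ph_append, ph_wd]

theorem rel_ph {w w' : FreeMonoid Letter} (h : ConGen.Rel Pi2Rel w w') :
    ConGen.Rel Pi2Rel (FreeMonoid.ofList (ph w.toList)) (FreeMonoid.ofList (ph w'.toList)) := by
  induction h with
  | of x y h =>
    obtain ⟨i, hi, rfl, rfl⟩ := h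
    refine .of _ _ ⟨i, hi, ?_, rfl⟩
    change FreeMonoid.ofList (ph (wdL i ++ wdL i)) = _
    rw [ph_append, ph_wd]
    rfl
  | refl x => exact .refl _
  | symm _ ih => exact ih.symm
  | trans _ _ ih ih' => exact ih.trans ih'
  | mul _ _ ih ih' =>
    rw [FreeMonoid.toList_mul, FreeMonoid.toList_mul, ph_append, ph_append]
    exact ih'.mul ih

theorem lam_cons {i : ℕ} (hi : 1 ≤ i) {t : List Letter} (h : t ∈ Lam∗) :
    wdL i ++ t ∈ Lam∗ := by
  obtain ⟨L, rfl, hL⟩ := h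
  refine ⟨wdL i :: L, by simp, ?_⟩
  intro y hy
  rcases List.mem_cons.1 hy with rfl | hy
  · exact ⟨i, hi, rfl⟩
  · exact hL y hy

def Q (x y : Letter) : Prop := P x y ∧ P (sw y) (sw x)

theorem final (u : List Letter) (h : u.IsChain Q) (hl : ∀ x ∈ u.getLast?, x = c) :
    ((∀ x ∈ u.head?, x = a) → u ∈ Lam∗) ∧
    (∀ x ∈ u.head?, x ≠ a → ∃ i t, u = List.replicate i b ++ c :: t ∧ t ∈ Lam∗ ∧
      (x = b → 1 ≤ i)) := by
  induction u with
  | nil => exact ⟨fun _ => ⟨[], by simp⟩, by simp⟩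
  | cons x u ih =>
    cases u with
    | nil =>
      simp at hl
      subst hl
      refine ⟨by simp, ?_⟩
      intro x hx _
      simp at hx
      subst hx
      exact ⟨0, [], by simp, ⟨[], by simp⟩, by simp⟩
    | cons y u =>
      obtain ⟨hq, h1⟩ := List.isChain_cons_cons.1 h
      obtain ⟨i1, i2⟩ := ih h1 (by simpa using hl)
      simp only [List.head?_cons, Option.mem_def, Option.some.injEq, forall_eq'] at i1 i2 ⊢
      constructor
      · rintro rfl
        have hy : y = b := by revert hq; cases y <;> simp [Q, P, sw]
        obtain ⟨i, t, e, ht, hi⟩ := i2 (by simp [hy])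
        rw [e]
        have := lam_cons (hi hy) ht
        simpa [wdL_eq] using this
      · intro hx
        cases x with
        | a => exact absurd rfl hx
        | b =>
          have hy : y ≠ a := by revert hq; cases y <;> simp [Q, P, sw]
          obtain ⟨i, t, e, ht, hi⟩ := i2 hy
          exact ⟨i + 1, t, by rw [e]; simp [List.replicate_succ], ht, by simp⟩
        | c =>
          have hy : y = a := by revert hq; cases y <;> simp [Q, P, sw]
          exact ⟨0, y :: u, by simp, i1 hy, by simp⟩

theorem main (u : List Letter) (h : Good u) (h' : Good (ph u)) : u ∈ Lam∗ := by
  obtain ⟨h1, h2⟩ := h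
  obtain ⟨h3, h4⟩ := h'
  have h5 : u.IsChain (fun x y => P (sw y) (sw x)) := by
    rw [ph, List.isChain_reverse, List.isChain_map] at h3
    exact h3
  have h6 : u.IsChain Q := by
    clear h2 h3 h4
    induction u with
    | nil => simp
    | cons x u ih =>
      cases u with
      | nil => simp
      | cons y u =>
        rw [List.isChain_cons_cons] at *
        exact ⟨⟨h1.1, h5.1⟩, ih h1.2 h5.2⟩
  refine (final u h6 h2).1 ?_
  intro x hx
  have := h4 (sw x) (by simp [ph] at hx ⊢; exact ⟨x, hx, rfl⟩)
  revert this
  cases x <;> simp [sw]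

end Aux

/-- Every `T₂`-irreducible word that is invertible in `Π₂` lies in `Λ*`. -/
theorem irreducible_invertible_mem_Lam_star (u : List Letter)
    (hirr : ∀ v : List Letter, ¬ Step u v)
    (hinv : IsUnit (Pi2Con.mk' (FreeMonoid.ofList u))) :
    u ∈ Lam∗ := by
  obtain ⟨m, h1, h2⟩ := isUnit_iff_exists.1 hinv
  obtain ⟨v, rfl⟩ := Con.mk'_surjective m
  rw [← map_mul, ← map_one Pi2Con.mk'] at h1 h2
  have h1' : ConGen.Rel Pi2Rel (FreeMonoid.ofList u * v) 1 := (Con.eq _).1 h1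
  have h2' : ConGen.Rel Pi2Rel (v * FreeMonoid.ofList u) 1 := (Con.eq _).1 h2
  refine Aux.main u (Aux.good_of_inv (v := v.toList) hirr h2') ?_
  have h3 := Aux.rel_ph h1'
  rw [FreeMonoid.toList_mul, Aux.ph_append] at h3
  exact Aux.good_of_inv (Aux.irr_ph hirr) h3
end

section
/- The group of units of Π₂ = Mon⟨a,b,c | (ab^i c)² = 1 (i ≥ 1)⟩ equals the submonoid of Π₂ generated by the elements represented by the words ab^i c (i ≥ 1): an element m ∈ Π₂ is a unit if and only if m lies in the submonoid ⟨Λ⟩ generated by Λ = { ab^i c : i ≥ 1 }. -/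
open Computability

namespace Sol
open Letter

abbrev M : Submonoid Pi2 :=
  Submonoid.closure {x : Pi2 | ∃ i : ℕ, 1 ≤ i ∧ x = Pi2Con.mk' (wd i)}

def q (x : Letter) : Pi2 := Pi2Con.mk' (FreeMonoid.of x)

lemma ofList_rep (i : ℕ) (x : Letter) :
    FreeMonoid.ofList (List.replicate i x) = FreeMonoid.of x ^ i := by
  induction i with
  | zero => rfl
  | succ n ih => rw [pow_succ', ← ih]; rfl

lemma wd_eq (i : ℕ) : wd i = FreeMonoid.of a * FreeMonoid.of b ^ i * FreeMonoid.of c := by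
  rw [← ofList_rep]; rfl

lemma mk_wd (i : ℕ) : Pi2Con.mk' (wd i) = q a * q b ^ i * q c := by
  rw [wd_eq, map_mul, map_mul, map_pow]; rfl

lemma mk_sq (i : ℕ) (hi : 1 ≤ i) : Pi2Con.mk' (wd i) * Pi2Con.mk' (wd i) = 1 := by
  rw [← map_mul, ← map_one Pi2Con.mk']
  exact (Con.eq _).2 (ConGen.Rel.of _ _ ⟨i, hi, rfl, rfl⟩)

def e (i : ℕ) (hi : 1 ≤ i) : M :=
  ⟨Pi2Con.mk' (wd i), Submonoid.subset_closure ⟨i, hi, rfl⟩⟩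

abbrev S := M × List (ℕ × M)

open Classical in
noncomputable def act : Letter → S → Option S
  | a, (g, L) => some (1, (0, g) :: L)
  | b, (_, []) => none
  | b, (g, (i, h) :: L) => if g = 1 then some (1, (i + 1, h) :: L) else none
  | c, (_, []) => none
  | c, (g, (i, h) :: L) =>
      if hi : 1 ≤ i then (if g = 1 then some (h * e i hi, L) else none) else none

noncomputable def gen (x : Letter) : (Function.End (Option S))ᵐᵒᵖ :=
  MulOpposite.op (fun o => o.bind (act x))

noncomputable def A0 : FreeMonoid Letter →* (Function.End (Option S))ᵐᵒᵖ := FreeMonoid.lift gen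

noncomputable def run (w : FreeMonoid Letter) (o : Option S) : Option S := (A0 w).unop o

lemma run_one (o : Option S) : run 1 o = o := by
  rw [run, map_one]; rfl
lemma run_mul (u v : FreeMonoid Letter) (o : Option S) : run (u * v) o = run v (run u o) := by
  rw [run, map_mul]; rfl
lemma run_of (x : Letter) (o : Option S) : run (FreeMonoid.of x) o = o.bind (act x) := by
  rw [run, A0, FreeMonoid.lift_eval_of]; rfl

lemma run_none (w : FreeMonoid Letter) : run w none = none := by
  induction w using FreeMonoid.inductionOn' with
  | one => exact run_one _
  | of_mul x w ih => rw [run_mul, run_of]; exact ih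

lemma run_b (i k : ℕ) (g : M) (L) :
    run (FreeMonoid.of b ^ i) (some (1, (k, g) :: L)) = some (1, (k + i, g) :: L) := by
  induction i with
  | zero => simp [run_one]
  | succ n ih => rw [pow_succ, run_mul, ih, run_of]; simp [act, add_assoc]

lemma run_wd (i : ℕ) (hi : 1 ≤ i) (g : M) (L) :
    run (wd i) (some (g, L)) = some (g * e i hi, L) := by
  have h : run (FreeMonoid.of a) (some (g, L)) = some (1, (0, g) :: L) := by
    rw [run_of]; rfl
  rw [wd_eq, run_mul, run_mul, h, run_b, run_of]
  simp [act, hi]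

lemma e_sq (i : ℕ) (hi : 1 ≤ i) : e i hi * e i hi = 1 := Subtype.ext (mk_sq i hi)

lemma con_le : Pi2Con ≤ Con.ker A0 := by
  apply Con.conGen_le.2
  rintro u v ⟨i, hi, rfl, rfl⟩
  apply MulOpposite.unop_injective
  funext o
  change run _ o = run _ o
  rw [run_one, run_mul]
  rcases o with _ | ⟨g, L⟩
  · simp [run_none]
  · rw [run_wd i hi, run_wd i hi, mul_assoc, e_sq, mul_one]

def valL : List (ℕ × M) → Pi2
  | [] => 1
  | (i, g) :: L => valL L * g * (q a * q b ^ i)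

def val (s : S) : Pi2 := valL s.2 * s.1

lemma act_val (x : Letter) (s t : S) (h : act x s = some t) : val t = val s * q x := by
  obtain ⟨g, L⟩ := s
  cases x with
  | a => simp only [act, Option.some.injEq] at h; subst h; simp [val, valL]
  | b =>
    rcases L with _ | ⟨⟨i, k⟩, L⟩
    · simp [act] at h
    · simp only [act] at h
      split_ifs at h with h1
      simp only [Option.some.injEq] at h; subst h; subst h1
      simp [val, valL, pow_succ, mul_assoc]
  | c =>
    rcases L with _ | ⟨⟨i, k⟩, L⟩
    · simp [act] at h
    · simp only [act] at h
      split_ifs at h with h1 h2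
      simp only [Option.some.injEq] at h; subst h; subst h2
      simp only [val, valL, e, Submonoid.coe_mul, mk_wd, Submonoid.coe_one, mul_assoc, one_mul]

lemma run_val (w : FreeMonoid Letter) : ∀ (s t : S), run w (some s) = some t →
    val t = val s * Pi2Con.mk' w := by
  induction w using FreeMonoid.inductionOn' with
  | one => intro s t h; rw [run_one] at h; cases h; rw [map_one, mul_one]
  | of_mul x w ih =>
    intro s t h
    rw [run_mul, run_of, Option.bind_some] at h
    rcases h1 : act x s with _ | r
    · rw [h1, run_none] at h; cases h
    · rw [h1] at h
      rw [ih _ _ h, act_val _ _ _ h1, map_mul, mul_assoc]; rfl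

def wt0 : FreeMonoid Letter →* Multiplicative ℤ :=
  FreeMonoid.lift (fun x => match x with
    | a => Multiplicative.ofAdd 1
    | b => 1
    | c => Multiplicative.ofAdd (-1))

lemma wt0_wd (i : ℕ) : wt0 (wd i) = 1 := by
  rw [wd_eq]; simp [wt0]

def wt : Pi2 →* Multiplicative ℤ := Con.lift Pi2Con wt0 (by
  apply Con.conGen_le.2
  rintro u v ⟨i, hi, rfl, rfl⟩
  change wt0 _ = wt0 _
  rw [map_mul, wt0_wd, map_one, mul_one])

lemma wt_mk (w) : wt (Pi2Con.mk' w) = wt0 w := rfl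

lemma wt_M (g : M) : wt g = 1 := by
  have : M ≤ MonoidHom.mker wt := by
    apply Submonoid.closure_le.2
    rintro x ⟨i, hi, rfl⟩
    exact wt0_wd i
  exact this g.2

lemma wt_valL (L : List (ℕ × M)) : (wt (valL L)).toAdd = L.length := by
  induction L with
  | nil => simp [valL]
  | cons p L ih =>
    have ha : wt (q a) = Multiplicative.ofAdd 1 := by rw [q, wt_mk, wt0, FreeMonoid.lift_eval_of]
    have hb : wt (q b) = 1 := by rw [q, wt_mk, wt0, FreeMonoid.lift_eval_of]
    simp [valL, wt_M, ha, hb, ih]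

lemma right_inv (u v : Pi2) (h : u * v = 1) : ∃ s : S, val s = u := by
  induction u using Con.induction_on with | _ u => ?_
  induction v using Con.induction_on with | _ v => ?_
  have h1 : Pi2Con (u * v) 1 := (Con.eq _).1 h
  have h2 : A0 (u * v) = A0 1 := con_le h1
  have h3 : run v (run u (some (1, []))) = some (1, []) := by
    rw [← run_mul, run, h2]; exact run_one _
  rcases h4 : run u (some (1, [])) with _ | s
  · rw [h4, run_none] at h3; cases h3
  · exact ⟨s, by rw [run_val _ _ _ h4]; simp [val, valL]⟩

lemma unit_M (u v : Pi2) (h : u * v = 1) (h' : v * u = 1) : u ∈ M := by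
  obtain ⟨⟨g, L⟩, rfl⟩ := right_inv u v h
  obtain ⟨⟨k, K⟩, rfl⟩ := right_inv v _ h'
  have h1 := congrArg (fun x => (wt x).toAdd) h
  simp only [val, map_mul, wt_M, mul_one, toAdd_mul, wt_valL, map_one, toAdd_one] at h1
  have : L = [] := List.length_eq_zero_iff.1 (by omega)
  subst this
  simp [val, valL]

end Sol

/-- The group of units of `Π₂` equals the submonoid generated by (the images of) the words
`a bⁱ c` (`i ≥ 1`): an element of `Π₂` is a unit iff it lies in this submonoid. -/
theorem units_eq_closure_Lam (m : Pi2) :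
    IsUnit m ↔
      m ∈ Submonoid.closure {x : Pi2 | ∃ i : ℕ, 1 ≤ i ∧ x = Pi2Con.mk' (wd i)} := by
  constructor
  · rintro ⟨u, rfl⟩
    exact Sol.unit_M _ _ u.mul_inv u.inv_mul
  · intro h
    induction h using Submonoid.closure_induction with
    | mem x hx =>
      obtain ⟨i, hi, rfl⟩ := hx
      exact ⟨⟨_, _, Sol.mk_sq i hi, Sol.mk_sq i hi⟩, rfl⟩
    | one => exact isUnit_one
    | mul x y _ _ hx hy => exact hx.mul hy
end

section
/- The group of units of Π₂ = Mon⟨a,b,c | (ab^i c)² = 1 (i ≥ 1)⟩ is isomorphic, as a group, to the free product of countably infinitely many cyclic groups of order 2, i.e. to the group presented by Gp⟨x_i (i ≥ 1) | x_i² = 1 (i ≥ 1)⟩. -/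
open Computability

namespace Pi2Proof

/-- The free product of copies of C2. -/
abbrev G_s13 := PresentedGroup {r : FreeGroup ℕ | ∃ i : ℕ, r = FreeGroup.of i ^ 2}

/-- Generators. -/
def gen (i : ℕ) : G_s13 := PresentedGroup.of i

theorem gen_sq (i : ℕ) : gen i * gen i = 1 := by
  have h : (PresentedGroup.mk {r : FreeGroup ℕ | ∃ i : ℕ, r = FreeGroup.of i ^ 2})
      (FreeGroup.of i ^ 2) = 1 := PresentedGroup.one_of_mem ⟨i, rfl⟩
  rw [pow_two, map_mul] at h
  exact h

/-- States of the automaton. -/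
abbrev St := Option (List (G_s13 × ℕ) × G_s13)

open Classical in
/-- Transition function. -/
noncomputable def act : Letter → St → St
  | _, none => none
  | Letter.a, some (S, g) => some ((g, 0) :: S, 1)
  | Letter.b, some ([], _) => none
  | Letter.b, some ((h, j) :: S, g) => if g = 1 then some ((h, j + 1) :: S, 1) else none
  | Letter.c, some ([], _) => none
  | Letter.c, some ((_, 0) :: _, _) => none
  | Letter.c, some ((h, j + 1) :: S, g) => if g = 1 then some (S, h * gen j) else none

/-- Right action of the free monoid. -/
noncomputable def rho0 : FreeMonoid Letter →* (Function.End St)ᵐᵒᵖ :=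
  FreeMonoid.lift fun x => MulOpposite.op (act x : Function.End St)

/-- run a word -/
noncomputable def run (w : FreeMonoid Letter) (s : St) : St := (rho0 w).unop s

theorem run_one (s : St) : run 1 s = s := by simp only [run, map_one]; rfl
theorem run_mul (u v : FreeMonoid Letter) (s : St) : run (u * v) s = run v (run u s) := by
  simp only [run, map_mul, MulOpposite.unop_mul]; rfl
theorem run_of (x : Letter) (s : St) : run (FreeMonoid.of x) s = act x s := by
  simp only [run, rho0, FreeMonoid.lift_eval_of]; rfl

theorem wd_eq (i : ℕ) : wd i = FreeMonoid.of Letter.a * FreeMonoid.of Letter.b ^ i *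
    FreeMonoid.of Letter.c := by
  have h : ∀ i : ℕ, FreeMonoid.ofList (List.replicate i Letter.b) = FreeMonoid.of Letter.b ^ i := by
    intro i
    induction i with
    | zero => rfl
    | succ n ih => rw [pow_succ', ← ih]; rfl
  rw [← h]; rfl

theorem run_bpow (j k : ℕ) (h : G_s13) (S : List (G_s13 × ℕ)) :
    run (FreeMonoid.of Letter.b ^ j) (some ((h, k) :: S, 1)) = some ((h, k + j) :: S, 1) := by
  induction j with
  | zero => rw [pow_zero, run_one]; rfl
  | succ n ih => rw [pow_succ, run_mul, ih, run_of]; simp [act, add_assoc]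

theorem run_wd (i : ℕ) (S : List (G_s13 × ℕ)) (g : G_s13) :
    run (wd (i + 1)) (some (S, g)) = some (S, g * gen i) := by
  rw [wd_eq, run_mul, run_mul, run_of, run_of]
  simp only [act]
  rw [run_bpow]
  simp [act]

theorem run_none (w : FreeMonoid Letter) : run w none = none := by
  induction w using FreeMonoid.inductionOn' with
  | one => exact run_one _
  | of_mul x w ih => rw [run_mul, run_of]; simpa [act] using ih

theorem rho0_le : Pi2Con ≤ Con.ker rho0 := by
  apply Con.conGen_le.2
  rintro u v ⟨i, hi, rfl, rfl⟩
  obtain ⟨i, rfl⟩ : ∃ k, i = k + 1 := ⟨i - 1, by omega⟩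
  rw [Con.ker_rel]
  apply MulOpposite.unop_injective
  funext s
  change run _ s = run _ s
  rw [run_mul, run_one]
  rcases s with _ | ⟨S, g⟩
  · simp [run_none]
  · rw [run_wd, run_wd, mul_assoc, gen_sq, mul_one]

/-- The action of Pi2. -/
noncomputable def rho : Pi2 →* (Function.End St)ᵐᵒᵖ := Con.lift Pi2Con rho0 rho0_le

/-- run an element -/
noncomputable def prun (w : Pi2) (s : St) : St := (rho w).unop s

theorem prun_mk (w : FreeMonoid Letter) (s : St) : prun (w : Pi2) s = run w s := by
  simp [prun, rho, run]

theorem prun_one (s : St) : prun 1 s = s := by simp only [prun, map_one]; rfl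
theorem prun_mul (u v : Pi2) (s : St) : prun (u * v) s = prun v (prun u s) := by
  simp only [prun, map_mul, MulOpposite.unop_mul]; rfl

theorem prun_none (w : Pi2) : prun w none = none := by
  induction w using Con.induction_on with
  | _ w => rw [prun_mk, run_none]

/-- letter in Pi2 -/
def L (x : Letter) : Pi2 := ((FreeMonoid.of x : FreeMonoid Letter) : Pi2)

theorem prun_L (x : Letter) (s : St) : prun (L x) s = act x s := by
  rw [L, prun_mk, run_of]

theorem wd_sq (i : ℕ) : ((wd (i + 1) : FreeMonoid Letter) : Pi2) * (wd (i + 1) : FreeMonoid Letter) = 1 := by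
  rw [← Con.coe_mul, ← Con.coe_one, Con.eq]
  exact ConGen.Rel.of _ _ ⟨i + 1, by omega, rfl, rfl⟩

/-- generator units -/
def ugen (i : ℕ) : Pi2ˣ := ⟨(wd (i + 1) : FreeMonoid Letter), (wd (i + 1) : FreeMonoid Letter), wd_sq i, wd_sq i⟩

/-- The hom from G. -/
def phi : G_s13 →* Pi2ˣ := PresentedGroup.toGroup (f := ugen) (by
  rintro r ⟨i, rfl⟩
  rw [map_pow, FreeGroup.lift_apply_of, pow_two]
  exact Units.ext (wd_sq i))

theorem phi_gen (i : ℕ) : phi (gen i) = ugen i := PresentedGroup.toGroup.of _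

theorem prun_phi (g : G_s13) : ∀ (S : List (G_s13 × ℕ)) (h : G_s13),
    prun (phi g : Pi2) (some (S, h)) = some (S, h * g) := by
  have hg : g ∈ Subgroup.closure (Set.range
      (PresentedGroup.of : ℕ → G_s13)) := by
    rw [PresentedGroup.closure_range_of]; trivial
  induction hg using Subgroup.closure_induction with
  | mem x hx =>
    obtain ⟨i, rfl⟩ := hx
    intro S h
    change prun (phi (gen i) : Pi2) _ = some (S, h * gen i)
    rw [phi_gen]
    exact (prun_mk _ _).trans (run_wd i S h)
  | one => intro S h; rw [map_one, Units.val_one, prun_one, mul_one]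
  | mul x y _ _ hx hy =>
    intro S h
    rw [map_mul, Units.val_mul, prun_mul, hx, hy, mul_assoc]
  | inv x _ hx =>
    intro S h
    have h1 := hx S (h * x⁻¹)
    rw [inv_mul_cancel_right] at h1
    rw [← h1, ← prun_mul, ← Units.val_mul, ← map_mul, mul_inv_cancel, map_one, Units.val_one,
      prun_one]

/-- value of a state -/
def ev : List (G_s13 × ℕ) → G_s13 → Pi2
  | [], g => (phi g : Pi2)
  | (h, j) :: S, g => ev S h * L Letter.a * L Letter.b ^ j * (phi g : Pi2)

theorem ev_mul (S : List (G_s13 × ℕ)) (g k : G_s13) : ev S (g * k) = ev S g * (phi k : Pi2) := by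
  cases S <;> simp [ev, mul_assoc]

theorem ugen_val (i : ℕ) : (ugen i : Pi2) = L Letter.a * L Letter.b ^ (i + 1) * L Letter.c := by
  change ((wd (i + 1) : FreeMonoid Letter) : Pi2) = _
  rw [wd_eq]
  rfl

theorem ev_act (x : Letter) (S T : List (G_s13 × ℕ)) (g k : G_s13)
    (h : act x (some (S, g)) = some (T, k)) : ev T k = ev S g * L x := by
  cases x with
  | a =>
    simp only [act, Option.some.injEq, Prod.mk.injEq] at h
    obtain ⟨rfl, rfl⟩ := h
    simp [ev]
  | b =>
    rcases S with _ | ⟨⟨m, j⟩, S⟩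
    · simp [act] at h
    · simp only [act] at h
      split_ifs at h with hg
      simp only [Option.some.injEq, Prod.mk.injEq] at h
      obtain ⟨rfl, rfl⟩ := h
      simp [ev, hg, pow_succ, mul_assoc]
  | c =>
    rcases S with _ | ⟨⟨m, _ | j⟩, S⟩
    · simp [act] at h
    · simp [act] at h
    · simp only [act] at h
      split_ifs at h with hg
      simp only [Option.some.injEq, Prod.mk.injEq] at h
      obtain ⟨rfl, rfl⟩ := h
      rw [ev_mul, phi_gen, ugen_val]
      simp [ev, hg, mul_assoc]

theorem ev_run (w : FreeMonoid Letter) : ∀ (S T : List (G_s13 × ℕ)) (g k : G_s13),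
    run w (some (S, g)) = some (T, k) → ev T k = ev S g * (w : Pi2) := by
  induction w using FreeMonoid.inductionOn' with
  | one =>
    intro S T g k h
    rw [run_one] at h
    simp only [Option.some.injEq, Prod.mk.injEq] at h
    obtain ⟨rfl, rfl⟩ := h
    simp
  | of_mul x w ih =>
    intro S T g k h
    rw [run_mul, run_of] at h
    rcases hs : act x (some (S, g)) with _ | ⟨R, m⟩
    · rw [hs, run_none] at h; simp at h
    · rw [hs] at h
      rw [ih _ _ _ _ h, ev_act x _ _ _ _ hs, Con.coe_mul, mul_assoc]; rfl

/-- not at empty stack -/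
def Bad (s : St) : Prop := ∀ g, s ≠ some ([], g)

theorem bad_a (s : St) : Bad (act Letter.a s) := by
  intro g
  rcases s with _ | ⟨S, h⟩ <;> simp [act]

theorem bad_b (s : St) (hs : Bad s) : Bad (act Letter.b s) := by
  intro g
  rcases s with _ | ⟨_ | ⟨⟨m, j⟩, S⟩, h⟩
  · simp [act]
  · simp [act]
  · simp only [act]; split_ifs <;> simp

theorem bad_bpow (j : ℕ) (s : St) (hs : Bad s) : Bad (prun (L Letter.b ^ j) s) := by
  induction j with
  | zero => simpa [prun_one] using hs
  | succ n ih => rw [pow_succ, prun_mul, prun_L]; exact bad_b _ ih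

theorem bad_phi (k : G_s13) (s : St) (hs : Bad s) : Bad (prun (phi k : Pi2) s) := by
  rcases s with _ | ⟨S, h⟩
  · rw [prun_none]; exact hs
  · rw [prun_phi]
    intro g hg
    simp only [Option.some.injEq, Prod.mk.injEq] at hg
    exact hs h (by rw [hg.1])

theorem phi_inj : Function.Injective phi := by
  intro g h e
  have h1 := prun_phi g [] 1
  rw [e, prun_phi] at h1
  simpa using h1.symm

theorem phi_surj : Function.Surjective phi := by
  intro u
  obtain ⟨w, hw⟩ : ∃ w : FreeMonoid Letter, (w : Pi2) = u :=
    Con.mk'_surjective (c := Pi2Con) (u : Pi2)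
  rcases hs : prun (u : Pi2) (some ([], 1)) with _ | ⟨S, g⟩
  · have h1 : prun ((u : Pi2) * (u⁻¹ : Pi2ˣ)) (some ([], 1)) = none := by
      rw [prun_mul, hs, prun_none]
    rw [Units.mul_inv, prun_one] at h1
    simp at h1
  · have h2 : ev S g = u := by
      rw [← hw, prun_mk] at hs
      rw [ev_run w _ _ _ _ hs, hw]
      simp [ev]
    rcases S with _ | ⟨⟨m, j⟩, S⟩
    · exact ⟨g, Units.ext h2⟩
    · exfalso
      have h3 : prun (((u⁻¹ : Pi2ˣ) : Pi2) * u) (some ([], 1)) = some ([], 1) := by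
        rw [Units.inv_mul, prun_one]
      rw [← h2] at h3
      simp only [ev, prun_mul, prun_L] at h3
      exact bad_phi _ _ (bad_bpow _ _ (bad_a _)) _ h3

end Pi2Proof

/-- The group of units of `Π₂` is isomorphic to the free product of countably infinitely many
cyclic groups of order 2, i.e. to `Gp⟨xᵢ (i ≥ 1) | xᵢ² = 1 (i ≥ 1)⟩`. -/
theorem units_Pi2_iso_free_product_C2 :
    Nonempty
      ((Pi2ˣ) ≃* PresentedGroup {r : FreeGroup ℕ | ∃ i : ℕ, r = FreeGroup.of i ^ 2}) := by
  exact ⟨(MulEquiv.ofBijective Pi2Proof.phi ⟨Pi2Proof.phi_inj, Pi2Proof.phi_surj⟩).symm⟩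
end

section
/- The group of units of Π₂ = Mon⟨a,b,c | (ab^i c)² = 1 (i ≥ 1)⟩ is not finitely generated as a group. -/
open Computability

abbrev GG := ℕ →₀ ZMod 2

abbrev St := Option (List (ℕ × GG) × GG)

open Classical in
/-- stack machine -/
noncomputable def stp : Letter → St → St
  | _, none => none
  | Letter.a, some (st, h) => some ((0, 0) :: st, h)
  | Letter.b, some ([], _) => none
  | Letter.b, some ((i, g) :: st, h) => if g = 0 then some ((i + 1, 0) :: st, h) else none
  | Letter.c, some ([], _) => none
  | Letter.c, some ([(i, g)], h) => if g = 0 then some ([], h + Finsupp.single i 1) else none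
  | Letter.c, some ((i, g) :: (j, g') :: st, h) =>
      if g = 0 then some ((j, g' + Finsupp.single i 1) :: st, h) else none

noncomputable def runHom : FreeMonoid Letter →* (Function.End St)ᵐᵒᵖ :=
  FreeMonoid.lift fun l => MulOpposite.op (stp l : Function.End St)

noncomputable def run (w : FreeMonoid Letter) (s : St) : St := (runHom w).unop s

theorem run_one (s : St) : run 1 s = s := by simp [run]; rfl

theorem run_mul (u v : FreeMonoid Letter) (s : St) : run (u * v) s = run v (run u s) := by
  simp [run, Function.End.mul_def]; rfl

theorem run_of (l : Letter) (s : St) : run (FreeMonoid.of l) s = stp l s := by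
  simp [run, runHom]; rfl

theorem wd_eq (i : ℕ) :
    wd i = FreeMonoid.of Letter.a * FreeMonoid.of Letter.b ^ i * FreeMonoid.of Letter.c := by
  have h : ∀ i, FreeMonoid.ofList (List.replicate i Letter.b) = FreeMonoid.of Letter.b ^ i := by
    intro i
    induction i with
    | zero => rfl
    | succ n ih => rw [List.replicate_succ, FreeMonoid.ofList_cons, ih, pow_succ']
  rw [← h]
  rfl

/-- add a group element at the top level -/
noncomputable def addTop (x : GG) : St → St
  | none => none
  | some ([], h) => some ([], h + x)
  | some ((j, g) :: st, h) => some ((j, g + x) :: st, h)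

theorem run_b_pow (i k : ℕ) (st : List (ℕ × GG)) (h : GG) :
    run (FreeMonoid.of Letter.b ^ i) (some ((k, 0) :: st, h)) = some ((k + i, 0) :: st, h) := by
  induction i generalizing k with
  | zero => simp [run_one]
  | succ n ih =>
    rw [pow_succ', run_mul, run_of]
    simp only [stp, if_true]
    rw [ih, show k + 1 + n = k + (n + 1) by omega]

theorem run_none (w : FreeMonoid Letter) : run w none = none := by
  induction w using FreeMonoid.inductionOn' with
  | one => exact run_one _
  | of_mul l w ih => rw [run_mul, run_of]; cases l <;> simpa [stp] using ih

theorem run_wd_s14 (i : ℕ) (s : St) : run (wd i) s = addTop (Finsupp.single i 1) s := by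
  rw [wd_eq, run_mul, run_mul, run_of, run_of]
  rcases s with _ | ⟨_ | ⟨⟨j, g⟩, st⟩, h⟩
  · simp [stp, run_none, addTop]
  · simp [stp, run_b_pow, addTop]
  · simp [stp, run_b_pow, addTop]

theorem single_add_self (i : ℕ) : (Finsupp.single i 1 + Finsupp.single i 1 : GG) = 0 := by
  rw [← Finsupp.single_add, show (1 + 1 : ZMod 2) = 0 by decide, Finsupp.single_zero]

theorem run_wd_sq (i : ℕ) (s : St) : run (wd i * wd i) s = s := by
  rw [run_mul, run_wd_s14, run_wd_s14]
  rcases s with _ | ⟨_ | ⟨⟨j, g⟩, st⟩, h⟩ <;> simp [addTop, add_assoc, single_add_self]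

theorem le_ker_run : Pi2Con ≤ Con.ker runHom := by
  refine Con.conGen_le.2 ?_
  rintro u v ⟨i, _, rfl, rfl⟩
  rw [Con.ker_rel]
  apply MulOpposite.unop_injective
  funext s
  exact (run_wd_sq i s).trans (run_one s).symm

noncomputable def actHom : Pi2 →* (Function.End St)ᵐᵒᵖ := Pi2Con.lift runHom le_ker_run

noncomputable def act (m : Pi2) (s : St) : St := (actHom m).unop s

theorem act_one (s : St) : act 1 s = s := by simp [act]; rfl

theorem act_mul (u v : Pi2) (s : St) : act (u * v) s = act v (act u s) := by
  simp [act, Function.End.mul_def]; rfl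

theorem act_mk (w : FreeMonoid Letter) (s : St) : act (w : Pi2) s = run w s := rfl

/-- depth change -/
def dl : Letter → ℤ
  | Letter.a => 1
  | Letter.b => 0
  | Letter.c => -1

def dHom : FreeMonoid Letter →* Multiplicative ℤ :=
  FreeMonoid.lift fun l => Multiplicative.ofAdd (dl l)

theorem dHom_of (l : Letter) : dHom (FreeMonoid.of l) = Multiplicative.ofAdd (dl l) := by
  simp [dHom]

theorem dHom_wd (i : ℕ) : dHom (wd i) = 1 := by
  rw [wd_eq, map_mul, map_mul, map_pow, dHom_of, dHom_of, dHom_of]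
  simp [dl]

theorem le_ker_d : Pi2Con ≤ Con.ker dHom := by
  refine Con.conGen_le.2 ?_
  rintro u v ⟨i, _, rfl, rfl⟩
  rw [Con.ker_rel]
  simp [dHom_wd]

def dPi : Pi2 →* Multiplicative ℤ := Pi2Con.lift dHom le_ker_d

theorem run_depth (w : FreeMonoid Letter) : ∀ (st st' : List (ℕ × GG)) (h h' : GG),
    run w (some (st, h)) = some (st', h') →
    (st'.length : ℤ) = st.length + (dHom w).toAdd := by
  induction w using FreeMonoid.inductionOn' with
  | one =>
    intro st st' h h' e
    rw [run_one] at e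
    simp only [Option.some.injEq, Prod.mk.injEq] at e
    simp [e.1]
  | of_mul l w ih =>
    intro st st' h h' e
    rw [run_mul, run_of] at e
    rw [map_mul, dHom_of, toAdd_mul, toAdd_ofAdd]
    cases l
    · have := ih _ _ _ _ e
      simp only [List.length_cons] at this
      simp only [dl]; push_cast at this; omega
    · rcases st with _ | ⟨⟨j, g⟩, st⟩
      · simp [stp, run_none] at e
      · simp only [stp] at e
        split_ifs at e
        · have := ih _ _ _ _ e
          simp only [List.length_cons] at this ⊢
          simp only [dl]; push_cast at this ⊢; omega
        · simp [run_none] at e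
    · rcases st with _ | ⟨⟨j, g⟩, _ | ⟨⟨k, g'⟩, st⟩⟩
      · simp [stp, run_none] at e
      · simp only [stp] at e
        split_ifs at e
        · have := ih _ _ _ _ e
          simp only [List.length_cons, List.length_nil] at this ⊢
          simp only [dl]; push_cast at this ⊢; omega
        · simp [run_none] at e
      · simp only [stp] at e
        split_ifs at e
        · have := ih _ _ _ _ e
          simp only [List.length_cons] at this ⊢
          simp only [dl]; push_cast at this ⊢; omega
        · simp [run_none] at e

theorem act_depth (m : Pi2) (st st' : List (ℕ × GG)) (h h' : GG)
    (e : act m (some (st, h)) = some (st', h')) :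
    (st'.length : ℤ) = st.length + (dPi m).toAdd := by
  induction m using Con.induction_on with
  | H w => exact run_depth w _ _ _ _ e

theorem act_none (m : Pi2) : act m none = none := by
  induction m using Con.induction_on with
  | H w => exact run_none w

/-- translation of the bottom level -/
noncomputable def bTrans (x : GG) : St → St := Option.map fun p => (p.1, x + p.2)

theorem stp_trans (l : Letter) (x : GG) (s : St) : stp l (bTrans x s) = bTrans x (stp l s) := by
  rcases s with _ | ⟨_ | ⟨⟨j, g⟩, _ | ⟨⟨k, g'⟩, st⟩⟩, h⟩ <;> cases l <;>
    simp only [bTrans, stp, Option.map_some, Option.map_none] <;>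
    split_ifs <;> simp [add_assoc]

theorem act_trans (m : Pi2) (x : GG) (s : St) : act m (bTrans x s) = bTrans x (act m s) := by
  induction m using Con.induction_on with
  | H w =>
    simp only [act_mk]
    induction w using FreeMonoid.inductionOn' generalizing s with
    | one => simp [run_one]
    | of_mul l w ih => rw [run_mul, run_mul, run_of, run_of, stp_trans, ih]

theorem unit_act (u : Pi2ˣ) : ∃ g : GG, act u (some ([], 0)) = some ([], g) := by
  have key : ∀ u : Pi2ˣ, ∃ st g, act u (some ([], 0)) = some (st, g) := by
    intro u
    rcases h : act u (some ([], 0)) with _ | ⟨st, g⟩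
    · have := act_mul u (u⁻¹ : Pi2ˣ) (some ([], 0))
      rw [h, act_none, Units.mul_inv, act_one] at this
      simp at this
    · exact ⟨st, g, rfl⟩
  obtain ⟨st, g, h⟩ := key u
  obtain ⟨st', g', h'⟩ := key u⁻¹
  have d := act_depth _ _ _ _ _ h
  have d' := act_depth _ _ _ _ _ h'
  have e : (dPi u).toAdd + (dPi (u⁻¹ : Pi2ˣ)).toAdd = 0 := by
    rw [← toAdd_mul, ← map_mul, Units.mul_inv, map_one, toAdd_one]
  simp only [List.length_nil] at d d'
  have : st.length = 0 := by omega
  rw [List.length_eq_zero_iff] at this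
  subst this
  exact ⟨g, h⟩

noncomputable def psi (u : Pi2ˣ) : GG := (unit_act u).choose

theorem psi_spec (u : Pi2ˣ) : act u (some ([], 0)) = some ([], psi u) := (unit_act u).choose_spec

theorem psi_eq {u : Pi2ˣ} {g : GG} (h : act u (some ([], 0)) = some ([], g)) : psi u = g := by
  rw [psi_spec] at h
  simpa using h

theorem psi_mul (u v : Pi2ˣ) : psi (u * v) = psi u + psi v := by
  apply psi_eq
  have : (some ([], psi u) : St) = bTrans (psi u) (some ([], 0)) := by simp [bTrans]
  rw [Units.val_mul, act_mul, psi_spec, this, act_trans, psi_spec]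
  simp [bTrans]

noncomputable def psiHom : Pi2ˣ →* Multiplicative GG :=
  MonoidHom.mk' (fun u => Multiplicative.ofAdd (psi u)) fun u v => by
    rw [psi_mul, ofAdd_add]

theorem wd_sq (i : ℕ) (hi : 1 ≤ i) : ((wd i : Pi2) * (wd i : Pi2)) = 1 :=
  (Con.eq Pi2Con).2 (ConGen.Rel.of _ _ ⟨i, hi, rfl, rfl⟩)

def gen (i : ℕ) (hi : 1 ≤ i) : Pi2ˣ := ⟨(wd i : Pi2), (wd i : Pi2), wd_sq i hi, wd_sq i hi⟩

theorem psi_gen (i : ℕ) (hi : 1 ≤ i) : psi (gen i hi) = Finsupp.single i 1 := by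
  apply psi_eq
  change run (wd i) _ = _
  rw [run_wd_s14]
  simp [addTop]

/-- The group of units of `Π₂` is not finitely generated as a group. -/
theorem units_Pi2_not_fg : ¬ Group.FG (Pi2ˣ) := by
  classical
  intro hfg
  obtain ⟨S, hS⟩ := Group.fg_def.1 hfg
  let B : Finset ℕ := insert 0 (S.biUnion fun u => (psi u).support)
  obtain ⟨N, hN⟩ := Infinite.exists_notMem_finset B
  simp only [B, Finset.mem_insert, Finset.mem_biUnion, not_or, not_exists, not_and,
    Finsupp.mem_support_iff, not_not] at hN
  obtain ⟨h0, hN⟩ := hN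
  have hN1 : 1 ≤ N := Nat.one_le_iff_ne_zero.2 h0
  have all : ∀ u : Pi2ˣ, psi u N = 0 := by
    let f : Pi2ˣ →* Multiplicative (ZMod 2) :=
      (AddMonoidHom.toMultiplicative (Finsupp.applyAddHom N)).comp psiHom
    have hf : f = 1 := MonoidHom.eq_of_eqOn_dense hS fun u hu => hN u hu
    intro u
    exact DFunLike.congr_fun hf u
  have := all (gen N hN1)
  rw [psi_gen] at this
  simp at this
end

section
/- For every integer n ≥ 3, the monoid Π_n = Mon⟨a,b,c | (ab^i c)^n = 1 (i ≥ 1)⟩ does not have context-free word problem: the language { u # rev(v) : u, v ∈ A*, u =_{Π_n} v } over A ∪ {#} is not context-free. -/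
open Computability

/-- The defining relations of `Π_n`: `(a bⁱ c)ⁿ = 1` for every `i ≥ 1`. -/
def PinRel (n : ℕ) (u v : FreeMonoid Letter) : Prop :=
  ∃ i : ℕ, 1 ≤ i ∧ u = wd i ^ n ∧ v = 1

/-- The least congruence on `A*` identifying `(a bⁱ c)ⁿ` with the empty word for all `i ≥ 1`;
its quotient is the monoid `Π_n = Mon⟨a,b,c | (a bⁱ c)ⁿ = 1 (i ≥ 1)⟩`. -/
def PinCon (n : ℕ) : Con (FreeMonoid Letter) := conGen (PinRel n)

/-- The word problem of `Π_n` (after Duncan & Gilman) over the alphabet `A ∪ {#}`, where the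
extra symbol `#` is encoded as `none` and the letters of `A` as `some _`. -/
def WPn (n : ℕ) : Language (Option Letter) :=
  {l | ∃ u v : List Letter, PinCon n (FreeMonoid.ofList u) (FreeMonoid.ofList v) ∧
    l = u.map some ++ [none] ++ (v.map some).reverse}


open ContextFreeGrammar in
inductive PDer {T : Type} (g : ContextFreeGrammar T) : List (Symbol T g.NT) → List T → Prop
  | nil : PDer g [] []
  | term (t : T) {s w} : PDer g s w → PDer g (Symbol.terminal t :: s) (t :: w)
  | nt (r : ContextFreeRule T g.NT) {s w1 w2} : r ∈ g.rules → PDer g r.output w1 → PDer g s w2 →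
      PDer g (Symbol.nonterminal r.input :: s) (w1 ++ w2)

inductive PNR {T : Type} (g : ContextFreeGrammar T) :
    Set g.NT → List (Symbol T g.NT) → List T → Prop
  | nil (S) : PNR g S [] []
  | term (S) (t : T) {s w} : PNR g S s w → PNR g S (Symbol.terminal t :: s) (t :: w)
  | nt (S) (r : ContextFreeRule T g.NT) {s w1 w2} : r ∈ g.rules → r.input ∉ S →
      PNR g (insert r.input S) r.output w1 → PNR g S s w2 →
      PNR g S (Symbol.nonterminal r.input :: s) (w1 ++ w2)

section pumping
variable {T : Type} {g : ContextFreeGrammar T}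

lemma PNR.der {S s w} (h : PNR g S s w) : PDer g s w := by
  induction h with
  | nil S => exact .nil
  | term S t _ ih => exact .term t ih
  | nt S r hr _ _ _ ih1 ih2 => exact .nt r hr ih1 ih2

lemma PNR.anti {S s w} (h : PNR g S s w) : ∀ S' ⊆ S, PNR g S' s w := by
  induction h with
  | nil S => intros; exact .nil _
  | term S t _ ih => intro S' h; exact .term _ t (ih _ h)
  | nt S r hr hn _ _ ih1 ih2 =>
    intro S' h
    exact .nt _ r hr (fun h' => hn (h h')) (ih1 _ (Set.insert_subset_insert h)) (ih2 _ h)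

lemma PNR.dich {S s w} (h : PNR g S s w) (A : g.NT) : PNR g (insert A S) s w ∨
    ∃ v x y, w = v ++ x ++ y ∧ ∃ S', PNR g S' [Symbol.nonterminal A] x := by
  induction h with
  | nil S => left; exact .nil _
  | term S t _ ih =>
    rcases ih with ih | ⟨v, x, y, rfl, h⟩
    · left; exact .term _ t ih
    · right; exact ⟨t :: v, x, y, by simp, h⟩
  | @nt S r s w1 w2 hr hn h1 h2 ih1 ih2 =>
    by_cases hA : r.input = A
    · right
      refine ⟨[], w1, w2, by simp, S, ?_⟩
      subst hA
      simpa using PNR.nt S r hr hn h1 (.nil _)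
    rcases ih1 with ih1 | ⟨v, x, y, rfl, h⟩
    · rcases ih2 with ih2 | ⟨v, x, y, rfl, h⟩
      · left
        refine .nt _ r hr ?_ ?_ ih2
        · simp [hA, hn]
        · rwa [Set.insert_comm]
      · right; exact ⟨w1 ++ v, x, y, by simp, h⟩
    · right; exact ⟨v, x, y ++ w2, by simp, h⟩

lemma PNR.consN {A : g.NT} {S s x w} (h : PNR g S [Symbol.nonterminal A] x) (h' : PNR g S s w) :
    PNR g S (Symbol.nonterminal A :: s) (x ++ w) := by
  cases h with
  | nt _ r hr hn h1 h2 =>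
    cases h2
    simpa using PNR.nt S r hr hn h1 h'

lemma PDer.append {s1 s2 : List (Symbol T g.NT)} {w1 w2} (h : PDer g s1 w1) (h' : PDer g s2 w2) :
    PDer g (s1 ++ s2) (w1 ++ w2) := by
  induction h with
  | nil => simpa
  | term t _ ih => exact .term t ih
  | nt r hr h1 _ _ ih2 =>
    rw [List.append_assoc]
    exact .nt r hr h1 ih2

lemma PDer.split {s2 : List (Symbol T g.NT)} : ∀ {s1 : List (Symbol T g.NT)} {w},
    PDer g (s1 ++ s2) w → ∃ w1 w2, w = w1 ++ w2 ∧ PDer g s1 w1 ∧ PDer g s2 w2 := by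
  intro s1
  induction s1 with
  | nil => intro w h; exact ⟨[], w, rfl, .nil, h⟩
  | cons a s1 ih =>
    intro w h
    rw [List.cons_append] at h
    cases h with
    | term t h =>
      obtain ⟨w1, w2, rfl, h1, h2⟩ := ih h
      exact ⟨t :: w1, w2, rfl, .term t h1, h2⟩
    | nt r hr h1 h =>
      obtain ⟨w1, w2, rfl, h1', h2⟩ := ih h
      exact ⟨_ ++ w1, w2, by rw [List.append_assoc], .nt r hr h1 h1', h2⟩

lemma PDer.of_derives {s : List (Symbol T g.NT)} {w : List T}
    (h : g.Derives s (w.map Symbol.terminal)) : PDer g s w := by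
  induction h using Relation.ReflTransGen.head_induction_on with
  | refl =>
    induction w with
    | nil => exact .nil
    | cons t w ih => exact .term t ih
  | head h _ ih =>
    obtain ⟨r, hr, h⟩ := h
    obtain ⟨p, q, rfl, rfl⟩ := h.exists_parts
    obtain ⟨w1, w2, rfl, h1, h2⟩ := PDer.split ih
    obtain ⟨w3, w4, rfl, h3, h4⟩ := PDer.split h1
    refine PDer.append (PDer.append h3 ?_) h2
    simpa using PDer.nt r hr h4 .nil

lemma PDer.derives {s : List (Symbol T g.NT)} {w : List T}
    (h : PDer g s w) : g.Derives s (w.map Symbol.terminal) := by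
  induction h with
  | nil => exact Relation.ReflTransGen.refl
  | term t _ ih => simpa using ih.append_left [Symbol.terminal t]
  | @nt r s w1 w2 hr h1 _ ih1 ih2 =>
    rw [List.map_append]
    have h : g.Produces (Symbol.nonterminal r.input :: s) (r.output ++ s) :=
      ⟨r, hr, .head s⟩
    exact h.trans_derives ((ih1.append_right s).trans (ih2.append_left _))

open Classical in
lemma PNR.bound (m : ℕ) (hm1 : 1 ≤ m) (hm : ∀ r ∈ g.rules, r.output.length ≤ m) {S s w}
    (h : PNR g S s w) :
    w.length ≤ s.length * m ^ ((g.rules.image (·.input)).filter (· ∉ S)).card := by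
  induction h with
  | nil S => simp
  | term S t _ ih =>
    simp only [List.length_cons, add_mul]
    have : 1 ≤ m ^ ((g.rules.image (·.input)).filter (· ∉ S)).card := Nat.one_le_pow _ _ hm1
    omega
  | @nt S r s w1 w2 hr hn h1 h2 ih1 ih2 =>
    have hc : ((g.rules.image (·.input)).filter (· ∉ insert r.input S)).card + 1 ≤
        ((g.rules.image (·.input)).filter (· ∉ S)).card := by
      rw [Nat.succ_le_iff]
      apply Finset.card_lt_card
      rw [Finset.ssubset_iff_of_subset]
      · refine ⟨r.input, ?_, ?_⟩
        · simp only [Finset.mem_filter, Finset.mem_image]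
          exact ⟨⟨r, hr, rfl⟩, hn⟩
        · simp
      · intro x hx
        simp only [Finset.mem_filter, Set.mem_insert_iff, not_or] at hx ⊢
        exact ⟨hx.1, hx.2.2⟩
    have h3 : w1.length ≤ m ^ ((g.rules.image (·.input)).filter (· ∉ S)).card := by
      refine ih1.trans ?_
      refine (Nat.mul_le_mul_right _ (hm r hr)).trans ?_
      rw [← pow_succ']
      refine Nat.pow_le_pow_right hm1 ?_
      convert hc
    simp only [List.length_append, List.length_cons, add_mul]
    omega

lemma pump_aux (K : ℕ) (hK : ∀ r ∈ g.rules, ∀ w, PNR g ∅ r.output w → w.length ≤ K) {s w}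
    (h : PDer g s w) : PNR g ∅ s w ∨ ∃ u v x y z : List T, w = u ++ v ++ x ++ y ++ z ∧
      v ++ y ≠ [] ∧ (v ++ x ++ y).length ≤ K ∧ PDer g s (u ++ x ++ z) := by
  induction h with
  | nil => left; exact .nil _
  | term t _ ih =>
    rcases ih with ih | ⟨u, v, x, y, z, rfl, hn, hl, hd⟩
    · left; exact .term _ t ih
    · right; exact ⟨t :: u, v, x, y, z, by simp, hn, hl, .term t hd⟩
  | @nt r s w1 w2 hr h1 h2 ih1 ih2 =>
    rcases ih1 with ih1 | ⟨u, v, x, y, z, rfl, hn, hl, hd⟩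
    · rcases ih2 with ih2 | ⟨u, v, x, y, z, rfl, hn, hl, hd⟩
      · rcases ih1.dich r.input with h | ⟨v, x, y, rfl, S, h⟩
        · left
          exact .nt _ r hr (by simp) h ih2
        · have h' := h.anti ∅ (by simp)
          by_cases hv : v ++ y = []
          · left
            obtain ⟨rfl, rfl⟩ := List.append_eq_nil_iff.1 hv
            simpa using h'.consN ih2
          · right
            exact ⟨[], v, x, y, w2, by simp, hv, hK r hr _ ih1, by
              simpa using h'.der.append h2⟩
      · right
        refine ⟨w1 ++ u, v, x, y, z, by simp, hn, hl, ?_⟩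
        simpa using PDer.nt r hr h1 hd
    · right
      refine ⟨u, v, x, y, z ++ w2, by simp, hn, hl, ?_⟩
      simpa using PDer.nt r hr hd h2

end pumping

theorem cf_pump {T : Type} {L : Language T} (h : L.IsContextFree) :
    ∃ K : ℕ, ∀ w ∈ L, K < w.length → ∃ u v x y z : List T, w = u ++ v ++ x ++ y ++ z ∧
      v ++ y ≠ [] ∧ (v ++ x ++ y).length ≤ K ∧ u ++ x ++ z ∈ L := by
  classical
  obtain ⟨g, rfl⟩ := h
  set m := g.rules.sup (·.output.length) + 1 with hm
  have hm' : ∀ r ∈ g.rules, r.output.length ≤ m := fun r hr =>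
    (Finset.le_sup (f := fun r : ContextFreeRule T g.NT => r.output.length) hr).trans (by omega)
  set k := ((g.rules.image (·.input)).filter (· ∉ (∅ : Set g.NT))).card with hk
  refine ⟨m * m ^ k, fun w hw hl => ?_⟩
  have hb : ∀ s w, PNR g ∅ s w → w.length ≤ s.length * m ^ k := by
    intro s w h
    convert h.bound m (by omega) hm'
  rcases pump_aux (m * m ^ k)
    (fun r hr w h => (hb _ _ h).trans (Nat.mul_le_mul_right _ (hm' r hr)))
    (PDer.of_derives ((g.mem_language_iff w).1 hw)) with h | ⟨u, v, x, y, z, h1, h2, h3, h4⟩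
  · have h1 := hb _ _ h
    have := Nat.mul_le_mul_right (m ^ k) (show 1 ≤ m by omega)
    simp only [List.length_singleton] at h1
    omega
  · exact ⟨u, v, x, y, z, h1, h2, h3, (g.mem_language_iff _).2 h4.derives⟩

lemma PinCon.hom {M : Type} [Monoid M] (n : ℕ) (f : FreeMonoid Letter →* M)
    (hf : ∀ i, 1 ≤ i → f (wd i) ^ n = 1) {u v} (h : PinCon n u v) : f u = f v := by
  have : PinCon n ≤ Con.ker f := by
    apply Con.conGen_le.2
    rintro x y ⟨i, hi, rfl, rfl⟩
    simp [Con.ker_rel, hf i hi]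
  exact this h


instance instDecEqLetter : DecidableEq Letter := fun x y => by
  cases x <;> cases y <;> first | exact isTrue rfl | exact isFalse (by simp)

def PP (K k : ℕ) : List Letter := (List.replicate k (wdL K)).flatten

lemma PP_succ (K k : ℕ) : PP K (k + 1) = wdL K ++ PP K k := by
  simp [PP, List.replicate_succ]

lemma PP_ofList (K k : ℕ) : FreeMonoid.ofList (PP K k) = wd K ^ k := by
  induction k with
  | zero => rfl
  | succ k ih => rw [PP_succ, FreeMonoid.ofList_append, ih, pow_succ']; rfl

lemma count_wdL (K : ℕ) : (wdL K).count Letter.c = 1 := by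
  simp [wdL, List.count_append, List.count_cons, List.count_replicate]

lemma count_PP (K k : ℕ) : (PP K k).count Letter.c = k := by
  induction k with
  | zero => rfl
  | succ k ih => rw [PP_succ, List.count_append, ih, count_wdL, add_comm]

lemma PP_prefix (K k : ℕ) (e z : List Letter) (h : PP K k = e ++ z) (hl : e.length ≤ K) :
    e.count Letter.c = 0 := by
  cases k with
  | zero =>
    have : e = [] := by
      simp [PP] at h
      exact h.1
    simp [this]
  | succ k =>
    rw [PP_succ] at h
    have h1 : e = (([Letter.a] ++ List.replicate K Letter.b) ++ ([Letter.c] ++ PP K k)).take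
        e.length := by
      have : ([Letter.a] ++ List.replicate K Letter.b) ++ ([Letter.c] ++ PP K k) = e ++ z := by
        rw [← h]; simp [wdL]
      rw [this]; simp
    rw [List.take_append_of_le_length (by simp; omega)] at h1
    rw [List.count_eq_zero]
    intro hc
    rw [h1] at hc
    have := List.mem_of_mem_take hc
    simp at this

lemma PP_window (K k : ℕ) : ∀ (u m z : List Letter), PP K k = u ++ m ++ z → m.length ≤ K →
    m.count Letter.c ≤ 1 := by
  induction k with
  | zero =>
    intro u m z h _
    have : m = [] := by
      simp [PP] at h
      exact h.2.1
    simp [this]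
  | succ k ih =>
    intro u m z h hl
    rw [PP_succ, List.append_assoc] at h
    rcases List.append_eq_append_iff.1 h with ⟨u', rfl, h2⟩ | ⟨d, h1, h2⟩
    · exact ih u' m z (by simpa using h2) hl
    · have hd : d.count Letter.c ≤ 1 := by
        have := count_wdL K
        rw [h1, List.count_append] at this
        omega
      rcases List.append_eq_append_iff.1 h2 with ⟨e, rfl, h4⟩ | ⟨e, rfl, h4⟩
      · rw [List.count_append] at hd
        omega
      · have := PP_prefix K k e z h4 (by simp at hl; omega)
        rw [List.count_append]
        omega

lemma lift_list {M : Type} [Monoid M] (f : Letter → M) (l : List Letter) :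
    FreeMonoid.lift f (FreeMonoid.ofList l) = (l.map f).prod := by
  rw [FreeMonoid.lift_apply]; rfl

def fc (M : Type) [AddMonoid M] (x y : M) : Letter → Multiplicative M
  | .a => Multiplicative.ofAdd x
  | .b => 1
  | .c => Multiplicative.ofAdd y

lemma fc_prod {M : Type} [AddCommMonoid M] (x y : M) (l : List Letter) :
    (l.map (fc M x y)).prod =
      Multiplicative.ofAdd (l.count Letter.a • x + l.count Letter.c • y) := by
  induction l with
  | nil => simp
  | cons t l ih =>
    rw [List.map_cons, List.prod_cons, ih]
    cases t <;> simp [fc, List.count_cons, add_smul, ← ofAdd_add] <;> abel_nf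

lemma count_wdL_a (K : ℕ) : (wdL K).count Letter.a = 1 := by
  simp [wdL, List.count_append, List.count_cons, List.count_replicate]

lemma fc_inv {M : Type} [AddCommMonoid M] (n : ℕ) (x y : M) (h : n • (x + y) = 0)
    {l : List Letter} (hl : PinCon n (FreeMonoid.ofList l) 1) :
    l.count Letter.a • x + l.count Letter.c • y = 0 := by
  have := PinCon.hom n (FreeMonoid.lift (fc M x y)) (by
    intro i _
    rw [wd, lift_list, fc_prod, count_wdL, count_wdL_a, ← ofAdd_nsmul]
    simp [h, one_smul]) hl
  rw [lift_list, fc_prod, map_one] at this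
  exact this

noncomputable def fe (ζ : ℂ) : Letter → Function.End ℂ
  | .a => fun z => z
  | .b => fun z => 1 + z
  | .c => fun z => ζ * z

noncomputable def FE (ζ : ℂ) (l : List Letter) : ℂ → ℂ := (l.map (fe ζ)).prod

lemma FE_nil (ζ z : ℂ) : FE ζ [] z = z := rfl

lemma FE_cons (ζ : ℂ) (t l) (z : ℂ) : FE ζ (t :: l) z = fe ζ t (FE ζ l z) := rfl

lemma FE_append (ζ : ℂ) (l m) (z : ℂ) : FE ζ (l ++ m) z = FE ζ l (FE ζ m z) := by
  simp only [FE, List.map_append, List.prod_append]; rfl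

lemma FE_aff (ζ : ℂ) (l : List Letter) :
    ∃ e, ∀ z, FE ζ l z = e + ζ ^ (l.count Letter.c) * z := by
  induction l with
  | nil => exact ⟨0, fun z => by simp [FE_nil]⟩
  | cons t l ih =>
    obtain ⟨e, ih⟩ := ih
    cases t
    · exact ⟨e, fun z => by simp [FE_cons, fe, ih]⟩
    · exact ⟨1 + e, fun z => by simp [FE_cons, fe, ih]; ring⟩
    · exact ⟨ζ * e, fun z => by simp [FE_cons, fe, ih, pow_succ]; ring⟩

lemma FE_b (ζ : ℂ) (l : List Letter) (ha : l.count Letter.a = 0) (hc : l.count Letter.c = 0)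
    (z : ℂ) : FE ζ l z = l.length + z := by
  induction l with
  | nil => simp [FE_nil]
  | cons t l ih =>
    cases t
    · simp at ha
    · simp at ha hc
      simp [FE_cons, fe, ih (by simpa using ha) (by simpa using hc)]
      ring
    · simp at hc

lemma FE_inv (n : ℕ) (ζ : ℂ) (h1 : ζ ≠ 1) (hn : ζ ^ n = 1)
    {l : List Letter} (hl : PinCon n (FreeMonoid.ofList l) 1) (z : ℂ) : FE ζ l z = z := by
  have := PinCon.hom n (FreeMonoid.lift (fe ζ)) (by
    intro i _
    rw [wd, lift_list]
    have hT : ∀ z, FE ζ (wdL i) z = i + ζ * z := by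
      intro z
      rw [wdL, FE_append, FE_append, FE_b ζ (List.replicate i Letter.b)]
      · simp [FE_cons, FE_nil, fe]
      · simp [List.count_replicate]
      · simp [List.count_replicate]
    have h2 : 1 - ζ ≠ 0 := sub_ne_zero.2 (Ne.symm h1)
    have key : ∀ (k : ℕ) (z : ℂ), (((wdL i).map (fe ζ)).prod ^ k) z =
        i / (1 - ζ) + ζ ^ k * (z - i / (1 - ζ)) := by
      intro k
      induction k with
      | zero => intro z; simp; rfl
      | succ k ih =>
        intro z
        rw [pow_succ]
        change (((wdL i).map (fe ζ)).prod ^ k) (FE ζ (wdL i) z) = _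
        rw [ih, hT]
        field_simp
        ring
    funext z
    rw [key, hn]
    simp
    rfl) hl
  rw [lift_list, map_one] at this
  exact congrFun this z

lemma main_letters (n : ℕ) (hn : 3 ≤ n) (K : ℕ) (hK : 1 ≤ K) (u v x y z : List Letter)
    (h : PP K n = u ++ v ++ x ++ y ++ z) (hne : v ++ y ≠ [])
    (hl : (v ++ x ++ y).length ≤ K) (hc : PinCon n (FreeMonoid.ofList (u ++ x ++ z)) 1) :
    False := by
  have hc0 : PinCon n (FreeMonoid.ofList (PP K n)) 1 := by
    rw [PP_ofList]
    exact ConGen.Rel.of _ _ ⟨K, hK, rfl, rfl⟩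
  have hw := PP_window K n u (v ++ x ++ y) z (by simpa using h) hl
  have hC : (PP K n).count Letter.c = n := count_PP K n
  have i1 := fc_inv (M := ZMod n) n 0 1 (by simp) hc
  have i2 := fc_inv (M := ℤ) n 1 (-1) (by simp) hc
  have i3 := fc_inv (M := ℤ) n 1 (-1) (by simp) hc0
  rw [h] at i3 hC
  simp only [smul_zero, zero_add, nsmul_eq_mul, mul_one] at i1
  rw [ZMod.natCast_eq_zero_iff] at i1
  simp only [List.count_append, nsmul_eq_mul, mul_one, mul_neg] at *
  push_cast at i2 i3
  have c0 : v.count Letter.c + y.count Letter.c = 0 := by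
    by_contra hne
    have : u.count Letter.c + x.count Letter.c + z.count Letter.c = n - 1 := by omega
    rw [this] at i1
    have := Nat.le_of_dvd (by omega) i1
    omega
  have a0 : v.count Letter.a + y.count Letter.a = 0 := by omega
  obtain ⟨ζ, hζ⟩ : ∃ ζ : ℂ, IsPrimitiveRoot ζ n :=
    ⟨_, Complex.isPrimitiveRoot_exp n (by omega)⟩
  have hζ1 : ζ ≠ 1 := hζ.ne_one (by omega)
  have e1 := FE_inv n ζ hζ1 hζ.pow_eq_one hc 0
  have e2 := FE_inv n ζ hζ1 hζ.pow_eq_one hc0 0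
  rw [h] at e2
  simp only [FE_append] at e1 e2
  rw [FE_b ζ v (by omega) (by omega), FE_b ζ y (by omega) (by omega)] at e2
  obtain ⟨eu, hu⟩ := FE_aff ζ u
  obtain ⟨ex, hx⟩ := FE_aff ζ x
  rw [hu, hx] at e1 e2
  have hz0 : ζ ≠ 0 := hζ.ne_zero (by omega)
  have e3 : ζ ^ (u.count Letter.c) * (v.length + ζ ^ (x.count Letter.c) * y.length) = 0 := by
    linear_combination e2 - e1
  have e4 := (mul_eq_zero.1 e3).resolve_left (pow_ne_zero _ hz0)
  have hpos : 0 < v.length + y.length := by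
    rw [← List.length_append]; exact List.length_pos_iff.2 hne
  have hx01 : x.count Letter.c = 0 ∨ x.count Letter.c = 1 := by omega
  rcases hx01 with hx0 | hx1
  · rw [hx0] at e4
    have : ((v.length + y.length : ℕ) : ℂ) = 0 := by push_cast; linear_combination e4
    rw [Nat.cast_eq_zero] at this
    omega
  · rw [hx1, pow_one] at e4
    have e5 : (v.length : ℂ) = - (ζ * y.length) := by linear_combination e4
    have hnz : ‖ζ‖ = 1 := hζ.norm'_eq_one (by omega)
    have e6 := congrArg norm e5
    simp [hnz] at e6
    rw [e6] at e4
    have hy : (y.length : ℂ) ≠ 0 := by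
      rw [Nat.cast_ne_zero]; omega
    have e7 : ζ = -1 := by
      have : (1 + ζ) * (y.length : ℂ) = 0 := by linear_combination e4
      have := (mul_eq_zero.1 this).resolve_right hy
      linear_combination this
    have e8 : ζ ^ 2 = 1 := by rw [e7]; norm_num
    have := Nat.le_of_dvd (by omega) (hζ.dvd_of_pow_eq_one 2 e8)
    omega

lemma getLast_aux {α : Type} (u v x y z : List (Option α)) (hv : none ∉ v) (hy : none ∉ y)
    (h : (u ++ v ++ x ++ y ++ z).getLast? = some none) :
    (u ++ x ++ z).getLast? = some none := by
  have hv' : v.getLast? ≠ some none := fun h => hv (List.mem_of_getLast? h)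
  have hy' : y.getLast? ≠ some none := fun h => hy (List.mem_of_getLast? h)
  simp_all [List.getLast?_append]
  tauto

lemma reduce_map_some {α : Type} (l : List α) : (l.map some).reduceOption = l := by
  induction l with
  | nil => rfl
  | cons a l ih => simp [ih]

lemma length_reduce {α : Type} (l : List (Option α)) (h : none ∉ l) :
    l.reduceOption.length = l.length := by
  induction l with
  | nil => rfl
  | cons a l ih =>
    cases a with
    | none => simp at h
    | some a => simp at h; simp [ih h]

/-- For every `n ≥ 3`, the monoid `Π_n` does not have context-free word problem. -/
theorem Pin_not_context_free (n : ℕ) (hn : 3 ≤ n) : ¬ (WPn n).IsContextFree := by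
  intro hcf
  obtain ⟨K0, hp⟩ := cf_pump hcf
  obtain ⟨K, hK1, hKK⟩ : ∃ K, 1 ≤ K ∧ K0 ≤ K := ⟨K0 + 1, by omega, by omega⟩
  have hmem : (PP K n).map some ++ [none] ∈ WPn n := by
    refine ⟨PP K n, [], ?_, by simp⟩
    rw [PP_ofList]
    exact ConGen.Rel.of _ _ ⟨K, hK1, rfl, rfl⟩
  have hlen : K0 < ((PP K n).map some ++ [none]).length := by
    obtain ⟨k, rfl⟩ : ∃ k, n = k + 1 := ⟨n - 1, by omega⟩
    rw [PP_succ]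
    simp [wdL]
    omega
  obtain ⟨u, v, x, y, z, hw, hne, hl, p, q, hpq, hd⟩ := hp _ hmem hlen
  have hcnt : ∀ l : List Letter, (l.map some).count none = 0 := by
    intro l
    rw [List.count_eq_zero]; simp
  have hc1 := congrArg (List.count none) hw
  have hc2 := congrArg (List.count none) hd
  simp only [List.count_append, List.count_reverse, hcnt, List.count_singleton_self] at hc1 hc2
  have hv : none ∉ v := List.count_eq_zero.1 (by omega)
  have hy : none ∉ y := List.count_eq_zero.1 (by omega)
  have hlast := getLast_aux u v x y z hv hy (by rw [← hw]; simp)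
  have hq : q = [] := by
    cases q with
    | nil => rfl
    | cons t q => 
      rw [hd, List.map_cons, List.reverse_cons, ← List.append_assoc, List.getLast?_append] at hlast
      simp at hlast
  subst hq
  have hr1 := congrArg List.reduceOption hw
  have hr2 := congrArg List.reduceOption hd
  simp only [List.reduceOption_append, reduce_map_some] at hr1 hr2
  refine main_letters n hn K hK1 u.reduceOption v.reduceOption x.reduceOption y.reduceOption
    z.reduceOption (by simpa using hr1) ?_ ?_ ?_
  · intro h0
    apply hne
    have := congrArg List.length h0
    rw [List.length_append, length_reduce v hv, length_reduce y hy] at this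
    rw [← List.length_eq_zero_iff, List.length_append]
    exact this
  · simp only [List.length_append] at hl ⊢
    have h1 := List.reduceOption_length_le v
    have h2 := List.reduceOption_length_le x
    have h3 := List.reduceOption_length_le y
    omega
  · rw [hr2]
    simpa using hpq
end
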